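/- arXiv:2104.11019 — 2 statements merged into one kernel-verified Lean document; each statement's English description precedes it below -/
import Mathlib

section
/- Let D be an arc-locally in-semicomplete digraph. Then D is diperfect if and only if D contains no induced directed odd cycle of length at least five. -/
variable {V : Type*}

/-- `u` and `v` are adjacent in the digraph with arc relation `A`. -/
def DAdj (A : V → V → Prop) (u v : V) : Prop := A u v ∨ A v u

/-- `A` is arc-locally in-semicomplete: for any four distinct vertices
`v1,v2,v3,v4` with `v1→v2`, `v2→v3`, `v4→v3`, the vertices `v1,v4` are adjacent. -/
def ArcLocallyIn (A : V → V → Prop) : Prop :=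
  ∀ v1 v2 v3 v4 : V, v1 ≠ v2 → v1 ≠ v3 → v1 ≠ v4 → v2 ≠ v3 → v2 ≠ v4 → v3 ≠ v4 →
    A v1 v2 → A v2 v3 → A v4 v3 → DAdj A v1 v4

/-- `A` is arc-locally out-semicomplete: for any four distinct vertices
`v1,v2,v3,v4` with `v2→v1`, `v2→v3`, `v3→v4`, the vertices `v1,v4` are adjacent. -/
def ArcLocallyOut (A : V → V → Prop) : Prop :=
  ∀ v1 v2 v3 v4 : V, v1 ≠ v2 → v1 ≠ v3 → v1 ≠ v4 → v2 ≠ v3 → v2 ≠ v4 → v3 ≠ v4 →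
    A v2 v1 → A v2 v3 → A v3 v4 → DAdj A v1 v4

/-- The underlying simple graph of the digraph `A`. -/
def Underlying (A : V → V → Prop) : SimpleGraph V := SimpleGraph.fromRel A

/-- A simple graph is perfect if every induced subgraph has chromatic number
equal to its clique number. -/
def GraphPerfect (G : SimpleGraph V) : Prop :=
  ∀ S : Set V, (G.induce S).chromaticNumber = ((G.induce S).cliqueNum : ℕ∞)

/-- A digraph is diperfect if its underlying graph is perfect. -/
def Diperfect (A : V → V → Prop) : Prop := GraphPerfect (Underlying A)

/-- The pairs of consecutive arcs `x ∈ S, y ∈ S, x→y` restricted to `S`. -/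
def ArcOn (A : V → V → Prop) (S : Set V) (x y : V) : Prop := x ∈ S ∧ y ∈ S ∧ A x y

/-- The induced subdigraph on `S` is strong. -/
def StrongOn (A : V → V → Prop) (S : Set V) : Prop :=
  ∀ u ∈ S, ∀ v ∈ S, Relation.ReflTransGen (ArcOn A S) u v

/-- `S` is (the vertex set of) a strong component: a maximal set inducing a
strong subdigraph. -/
def IsStrongComponent (A : V → V → Prop) (S : Set V) : Prop :=
  S.Nonempty ∧ StrongOn A S ∧ ∀ T : Set V, S ⊆ T → StrongOn A T → T ⊆ S

/-- The strong component `S` is initial: no outside vertex dominates a vertex of `S`. -/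
def IsInitial (A : V → V → Prop) (S : Set V) : Prop :=
  ∀ v, v ∉ S → ∀ u ∈ S, ¬ A v u

/-- The digraph is strong. -/
def IsStrong (A : V → V → Prop) : Prop := ∀ u v : V, Relation.ReflTransGen A u v

/-- There is a directed path from `u` to `v`. -/
def Reach (A : V → V → Prop) (u v : V) : Prop := Relation.ReflTransGen A u v

/-- The induced subdigraph on `S` is semicomplete. -/
def SemicompleteOn (A : V → V → Prop) (S : Set V) : Prop :=
  ∀ u ∈ S, ∀ v ∈ S, u ≠ v → DAdj A u v

/-- The induced subdigraph on `S` is bipartite (its underlying graph is 2-colorable). -/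
def BipartiteOn (A : V → V → Prop) (S : Set V) : Prop :=
  ∃ T : Set V, ∀ u ∈ S, ∀ v ∈ S, DAdj A u v →
    ((u ∈ T ∧ v ∉ T) ∨ (u ∉ T ∧ v ∈ T))

/-- The induced subdigraph on `S` is connected (in the underlying graph). -/
def ConnOn (A : V → V → Prop) (S : Set V) : Prop :=
  ∀ u ∈ S, ∀ v ∈ S,
    Relation.ReflTransGen (fun x y => x ∈ S ∧ y ∈ S ∧ DAdj A x y) u v

/-- The digraph is connected. -/
def IsConnected' (A : V → V → Prop) : Prop := ConnOn A Set.univ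

/-- `D` has a clique cut: a set `B` inducing a semicomplete subdigraph whose
removal disconnects the digraph. -/
def HasCliqueCut (A : V → V → Prop) : Prop :=
  ∃ B : Set V, SemicompleteOn A B ∧ ¬ ConnOn A Bᶜ

/-- The induced subdigraph on `S` is an extended cycle of length `k`:
`S` is partitioned into `k` nonempty (necessarily stable) sets `X 0, …, X (k-1)`
and the arcs between vertices of `S` are exactly those from `X i` to `X (i+1)`
(indices modulo `k`). -/
def IsExtendedCycleOn (A : V → V → Prop) (S : Set V) (k : ℕ) : Prop :=
  2 ≤ k ∧ ∃ X : ZMod k → Set V,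
    (∀ i, (X i).Nonempty) ∧
    (∀ i j, i ≠ j → Disjoint (X i) (X j)) ∧
    (⋃ i, X i) = S ∧
    (∀ u ∈ S, ∀ v ∈ S, (A u v ↔ ∃ i, u ∈ X i ∧ v ∈ X (i + 1)))

/-- The induced subdigraph on `S` is an odd extended cycle of length at least five. -/
def IsOddExtCycle5On (A : V → V → Prop) (S : Set V) : Prop :=
  ∃ k : ℕ, Odd k ∧ 5 ≤ k ∧ IsExtendedCycleOn A S k


namespace ALI

/-- Every bound on the clique number gives a colouring. -/
def GoodG {V : Type*} (G : SimpleGraph V) : Prop := ∀ k : ℕ, G.CliqueFree (k + 1) → G.Colorable k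

lemma good_dom {V : Type*} (G : SimpleGraph V)
    (hind : ∀ S : Set V, S ≠ Set.univ → GoodG (G.induce S)) (u v : V) (huv : u ≠ v)
    (hn : ¬ G.Adj u v) (h : ∀ w, G.Adj u w → G.Adj v w) : GoodG G := by
  classical
  intro k hk
  have h1 : ({u}ᶜ : Set V) ≠ Set.univ := by
    intro h
    have : u ∈ ({u}ᶜ : Set V) := by rw [h]; trivial
    simp at this
  obtain ⟨C⟩ := hind _ h1 k (hk.comap ⟨(SimpleGraph.Embedding.induce _).toCopy⟩)
  refine ⟨SimpleGraph.Coloring.mk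
    (fun x => if hx : x = u then C ⟨v, by simpa using huv.symm⟩ else C ⟨x, by simpa using hx⟩) ?_⟩
  intro x y hxy
  by_cases hx : x = u
  · subst hx
    have hy : y ≠ x := hxy.ne'
    simp only [dif_pos, hy, dif_neg, not_false_iff]
    exact C.valid (by simpa using h y hxy)
  · by_cases hy : y = u
    · subst hy
      simp only [hx, dif_pos, dif_neg, not_false_iff]
      exact C.valid (by simpa using (h x hxy.symm).symm)
    · simp only [hx, hy, dif_neg, not_false_iff]
      exact C.valid (by simpa using hxy)

lemma good_stable {V : Type*} (G : SimpleGraph V)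
    (hind : ∀ S : Set V, S ≠ Set.univ → GoodG (G.induce S)) (M : Set V)
    (hM : ∀ u ∈ M, ∀ v ∈ M, ¬ G.Adj u v)
    (hK : ∀ K : Finset V, G.IsClique K → (∀ x ∈ K, x ∉ M) → ∃ m ∈ M, ∀ x ∈ K, G.Adj m x) :
    GoodG G := by
  classical
  intro k hk
  obtain ⟨m0, hm0, -⟩ := hK ∅ (by simp) (by simp)
  have h1 : (Mᶜ : Set V) ≠ Set.univ := by
    intro h
    have : m0 ∈ (Mᶜ : Set V) := by rw [h]; trivial
    exact this hm0
  obtain _ | k := k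
  · exfalso
    apply hk {m0}
    simp [SimpleGraph.isNClique_iff]
  have hfree : (G.induce (Mᶜ)).CliqueFree (k + 1) := by
    intro K hKc
    obtain ⟨m, hm, hadj⟩ := hK (K.map (Function.Embedding.subtype _)) (by
      intro x hx y hy hxy
      simp only [Finset.coe_map, Set.mem_image, Finset.mem_coe] at hx hy
      obtain ⟨x', hx', rfl⟩ := hx
      obtain ⟨y', hy', rfl⟩ := hy
      have := hKc.1 hx' hy' (by rintro rfl; exact hxy rfl)
      simpa using this) (by
      intro x hx
      simp only [Finset.mem_map] at hx
      obtain ⟨x', hx', rfl⟩ := hx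
      exact x'.2)
    apply hk (insert m (K.map (Function.Embedding.subtype _)))
    have := (hKc.map (f := Function.Embedding.subtype (· ∈ Mᶜ)))
    refine SimpleGraph.IsNClique.insert (this.mono ?_) hadj
    rw [SimpleGraph.map_le_iff_le_comap]
  obtain ⟨C⟩ := hind _ h1 k hfree
  refine ⟨SimpleGraph.Coloring.mk
    (fun x => if hx : x ∈ M then Fin.last k else (C ⟨x, hx⟩).castSucc) ?_⟩
  intro x y hxy
  by_cases hx : x ∈ M
  · have hy : y ∉ M := fun hy => hM x hx y hy hxy
    simp only [hx, hy, dif_pos, dif_neg, not_false_iff]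
    exact (Fin.castSucc_lt_last _).ne'
  · by_cases hy : y ∈ M
    · simp only [hx, hy, dif_pos, dif_neg, not_false_iff]
      exact (Fin.castSucc_lt_last _).ne
    · simp only [hx, hy, dif_neg, not_false_iff]
      intro h
      exact C.valid (v := ⟨x, hx⟩) (w := ⟨y, hy⟩) (by simpa using hxy) (Fin.castSucc_injective _ h)

lemma exists_perm {α : Type*} {k : ℕ} (C : Set α) (f g : α → Fin k) (hf : Set.InjOn f C)
    (hg : Set.InjOn g C) : ∃ σ : Equiv.Perm (Fin k), ∀ x ∈ C, σ (g x) = f x := by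
  classical
  let e : {y // y ∈ Set.image g C} ≃ {y // y ∈ Set.image f C} :=
    (Equiv.Set.imageOfInjOn g C hg).symm.trans (Equiv.Set.imageOfInjOn f C hf)
  refine ⟨e.extendSubtype, fun x hx => ?_⟩
  rw [Equiv.extendSubtype_apply_of_mem _ _ (Set.mem_image_of_mem g hx)]
  have : (Equiv.Set.imageOfInjOn g C hg).symm ⟨g x, Set.mem_image_of_mem g hx⟩ = ⟨x, hx⟩ := by
    rw [Equiv.symm_apply_eq]; rfl
  simp only [e, Equiv.trans_apply, this]
  rfl

lemma good_cut {V : Type*} (G : SimpleGraph V)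
    (hind : ∀ S : Set V, S ≠ Set.univ → GoodG (G.induce S)) (L C : Set V)
    (hLC : ∀ x ∈ L, x ∉ C) (hL : L.Nonempty) (hne : ∃ z, z ∉ L ∧ z ∉ C)
    (hC : ∀ x ∈ C, ∀ y ∈ C, x ≠ y → G.Adj x y)
    (hLR : ∀ x ∈ L, ∀ y, y ∉ L → y ∉ C → ¬ G.Adj x y) : GoodG G := by
  classical
  intro k hk
  obtain ⟨l, hl⟩ := hL
  obtain ⟨z, hz1, hz2⟩ := hne
  have h1 : (Lᶜ : Set V) ≠ Set.univ := by
    intro h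
    have : l ∈ (Lᶜ : Set V) := by rw [h]; trivial
    exact this hl
  have h2 : (L ∪ C : Set V) ≠ Set.univ := by
    intro h
    have : z ∈ (L ∪ C : Set V) := by rw [h]; trivial
    exact this.elim hz1 hz2
  obtain ⟨c1⟩ := hind _ h1 k (hk.comap ⟨(SimpleGraph.Embedding.induce _).toCopy⟩)
  obtain ⟨c2⟩ := hind _ h2 k (hk.comap ⟨(SimpleGraph.Embedding.induce _).toCopy⟩)
  let f : V → Fin k := fun x => if hx : x ∈ L then c2 ⟨x, Or.inl hx⟩ else c1 ⟨x, hx⟩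
  let g : V → Fin k := fun x => if hx : x ∈ L ∪ C then c2 ⟨x, hx⟩ else c1 ⟨z, hz1⟩
  have hfv : ∀ x y, x ∉ L → y ∉ L → G.Adj x y → f x ≠ f y := by
    intro x y hx hy hxy
    simp only [f, hx, hy, dif_neg, not_false_iff]
    exact c1.valid (by simpa using hxy)
  have hgv : ∀ x y, x ∈ L ∪ C → y ∈ L ∪ C → G.Adj x y → g x ≠ g y := by
    intro x y hx hy hxy
    simp only [g, hx, hy, dif_pos]
    exact c2.valid (by simpa using hxy)
  obtain ⟨σ, hσ⟩ := exists_perm C f g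
    (by
      intro x hx y hy h
      by_contra hxy
      exact hfv x y (fun h => hLC x h hx) (fun h => hLC y h hy) (hC x hx y hy hxy) h)
    (by
      intro x hx y hy h
      by_contra hxy
      exact hgv x y (Or.inr hx) (Or.inr hy) (hC x hx y hy hxy) h)
  have key : ∀ x ∈ L, ∀ y, G.Adj x y → σ (g x) ≠ (if y ∈ L then σ (g y) else f y) := by
    intro x hx y hxy
    by_cases hy : y ∈ L
    · simp only [hy, if_true]
      exact fun h => hgv x y (Or.inl hx) (Or.inl hy) hxy (σ.injective h)
    · have hyC : y ∈ C := by
        by_contra h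
        exact hLR x hx y hy h hxy
      simp only [hy, if_false]
      rw [← hσ y hyC]
      exact fun h => hgv x y (Or.inl hx) (Or.inr hyC) hxy (σ.injective h)
  refine ⟨SimpleGraph.Coloring.mk (fun x => if x ∈ L then σ (g x) else f x) ?_⟩
  intro x y hxy
  by_cases hx : x ∈ L
  · have := key x hx y hxy
    simpa [hx] using this
  · by_cases hy : y ∈ L
    · have := key y hy x hxy.symm
      simp only [hx, hy, if_true, if_false] at this ⊢
      exact this.symm
    · simp only [hx, hy, if_false]
      exact hfv x y hx hy hxy


section Strong

variable {V : Type*} {A : V → V → Prop}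

lemma ali (hirr : Irreflexive A) (hD : ArcLocallyIn A) {v1 v2 v3 v4 : V} (h12 : A v1 v2)
    (h23 : A v2 v3) (h43 : A v4 v3) (n13 : v1 ≠ v3) (n14 : v1 ≠ v4) (n24 : v2 ≠ v4) :
    A v1 v4 ∨ A v4 v1 := by
  refine hD v1 v2 v3 v4 ?_ n13 n14 ?_ n24 ?_ h12 h23 h43
  · rintro rfl; exact hirr _ h12
  · rintro rfl; exact hirr _ h23
  · rintro rfl; exact hirr _ h43

lemma und_adj (hirr : Irreflexive A) {u v : V} : (Underlying A).Adj u v ↔ (A u v ∨ A v u) := by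
  unfold Underlying
  rw [SimpleGraph.fromRel_adj]
  constructor
  · exact fun h => h.2
  · intro h
    refine ⟨?_, h⟩
    rintro rfl
    exact h.elim (hirr _) (hirr _)

/-- Crossing lemma. -/
lemma cross {R : V → V → Prop} (P : V → Prop) {u v : V} (h : Relation.ReflTransGen R u v)
    (hu : ¬ P u) (hv : P v) : ∃ x y, ¬ P x ∧ P y ∧ R x y := by
  induction h with
  | refl => exact absurd hv hu
  | @tail b c _ hbc ih =>
    by_cases hb : P b
    · exact ih hb
    · exact ⟨b, c, hb, hv, hbc⟩

lemma first_step {R : V → V → Prop} {u v : V} (h : Relation.ReflTransGen R u v)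
    (huv : u ≠ v) : ∃ x, R u x := by
  rcases Relation.ReflTransGen.cases_head h with h | ⟨x, hx, _⟩
  · exact absurd h huv
  · exact ⟨x, hx⟩

set_option maxHeartbeats 2000000 in
/-- Key configuration: `a→b→c→a`, `b→x→a`, `x≁c`. -/
lemma cfg_false (hirr : Irreflexive A) (hD : ArcLocallyIn A)
    (hs : ∀ u v, Relation.ReflTransGen A u v)
    {a b c x y : V} (hab : A a b) (hbc : A b c) (hca : A c a) (hbx : A b x) (hxa : A x a)
    (hxc : ¬ A x c) (hcx : ¬ A c x) (hne : x ≠ c) (hcy : A c y) (hxy : ¬ A x y) (hyx : ¬ A y x)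
    (ya : y ≠ a) (yb : y ≠ b) (yx : y ≠ x) : False := by
  have irr : ∀ u v, A u v → u ≠ v := by rintro u v h rfl; exact hirr _ h
  have L := @ali V A hirr hD
  have nab := irr _ _ hab
  have nbc := irr _ _ hbc
  have nca := irr _ _ hca
  have nbx := irr _ _ hbx
  have nxa := irr _ _ hxa
  have yc := (irr _ _ hcy).symm
  -- every vertex outside is adjacent to the configuration
  have near : ∀ v, (v = a ∨ v = b ∨ v = c ∨ v = x) ∨ (A v a ∨ A v b ∨ A v c ∨ A v x) ∨
      (A a v ∨ A b v ∨ A c v ∨ A x v) := by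
    intro v
    have := hs v a
    induction this using Relation.ReflTransGen.head_induction_on with
    | refl => simp
    | @head v v' hvv' _ ih =>
      by_cases hv : v = a ∨ v = b ∨ v = c ∨ v = x
      · exact Or.inl hv
      right
      push Not at hv
      obtain ⟨va, vb, vc, vx⟩ := hv
      by_cases hv' : v' = a ∨ v' = b ∨ v' = c ∨ v' = x
      · rcases hv' with rfl | rfl | rfl | rfl <;> tauto
      rcases ih with h | h | h
      · exact absurd h hv'
      · push Not at hv'
        obtain ⟨v'a, v'b, v'c, v'x⟩ := hv'
        rcases h with h | h | h | h
        · have := L hvv' h hca va vc v'c; tauto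
        · have := L hvv' h hab vb va v'a; tauto
        · have := L hvv' h hbc vc vb v'b; tauto
        · have := L hvv' h hbx vx vb v'b; tauto
      · push Not at hv'
        obtain ⟨v'a, v'b, v'c, v'x⟩ := hv'
        rcases h with h | h | h | h
        · have := L hca h hvv' v'c.symm vc.symm va.symm; tauto
        · have := L hab h hvv' v'a.symm va.symm vb.symm; tauto
        · have := L hbc h hvv' v'b.symm vb.symm vc.symm; tauto
        · have := L hbx h hvv' v'b.symm vb.symm vx.symm; tauto
  -- y dominates nothing
  have nay : ¬ A a y := by
    intro h
    have := L hxa h hcy yx.symm hne nca.symm; tauto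
  have nya : ¬ A y a := by
    intro h
    have := L hcy h hxa nca hne.symm yx; tauto
  have nyb : ¬ A y b := by
    intro h
    have := L hxa hab h nbx.symm yx.symm ya.symm; tauto
  have nyc : ¬ A y c := by
    intro h
    have := L h hca hxa ya yx hne.symm; tauto
  obtain ⟨p, hyp⟩ := first_step (hs y a) ya
  have pa : p ≠ a := by rintro rfl; exact nya hyp
  have pb : p ≠ b := by rintro rfl; exact nyb hyp
  have pc : p ≠ c := by rintro rfl; exact nyc hyp
  have px : p ≠ x := by rintro rfl; exact hyx hyp
  have py := (irr _ _ hyp).symm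
  have npa : ¬ A p a := by
    intro h
    have := L hyp h hxa ya yx px; tauto
  have npb : ¬ A p b := by
    intro h
    have := L hyp h hab yb ya pa; tauto
  have nap : ¬ A a p := by
    intro h
    have := L hxa h hyp px.symm yx.symm ya.symm; tauto
  have npc : ¬ A p c := by
    intro h
    have hby : A b y := by
      have := L hyp h hbc yc yb pb; tauto
    have hbp : A b p := by
      have := L h hcy hby py pb nbc.symm; tauto
    have := L hab hbc h nca.symm pa.symm pb.symm; tauto
  have npx : ¬ A p x := by
    intro h
    have := L hab hbx h nxa.symm pa.symm pb.symm; tauto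
  have nbp : ¬ A b p := by
    intro h
    have := L hab h hyp pa.symm ya.symm yb.symm; tauto
  have nxp : ¬ A x p := by
    intro h
    have := L hcy hyp h pc.symm hne.symm yx; tauto
  obtain ⟨q, hpq⟩ := first_step (hs p a) pa
  have qa : q ≠ a := by rintro rfl; exact npa hpq
  have qb : q ≠ b := by rintro rfl; exact npb hpq
  have qc : q ≠ c := by rintro rfl; exact npc hpq
  have qx : q ≠ x := by rintro rfl; exact npx hpq
  rcases near q with h | h | h
  · tauto
  · rcases h with h | h | h | h
    · have := L hpq h hxa pa px qx; tauto
    · have := L hpq h hab pb pa qa; tauto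
    · have := L hpq h hbc pc pb qb; tauto
    · have := L hpq h hbx px pb qb; tauto
  · rcases h with h | h | h | h
    · have := L hxa h hpq qx.symm px.symm pa.symm; tauto
    · have := L hab h hpq qa.symm pa.symm pb.symm; tauto
    · have := L hbc h hpq qb.symm pb.symm pc.symm; tauto
    · have := L hbx h hpq qb.symm pb.symm px.symm; tauto

lemma tri_adj (hirr : Irreflexive A) (hD : ArcLocallyIn A)
    (hs : ∀ u v, Relation.ReflTransGen A u v)
    (hdom : ∀ u v, u ≠ v → ¬ (A u v ∨ A v u) → ∃ w, (A u w ∨ A w u) ∧ ¬ (A v w ∨ A w v))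
    {a b c x : V} (hab : A a b) (hbc : A b c) (hca : A c a) (hxa : A x a)
    (nxb : x ≠ b) (nxc : x ≠ c) : (A x b ∨ A b x) ∧ (A x c ∨ A c x) := by
  have irr : ∀ u v, A u v → u ≠ v := by rintro u v h rfl; exact hirr _ h
  have L := @ali V A hirr hD
  have nab := irr _ _ hab
  have nbc := irr _ _ hbc
  have nca := irr _ _ hca
  have nxa := irr _ _ hxa
  have h1 := L hbc hca hxa nab.symm nxb.symm nxc.symm
  refine ⟨h1.symm, ?_⟩
  rcases h1 with hbx | hxb
  · by_contra hcon
    obtain ⟨y, hy1, hy2⟩ := hdom c x nxc.symm (by tauto)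
    have ya : y ≠ a := by rintro rfl; tauto
    have yb : y ≠ b := by rintro rfl; tauto
    have yx : y ≠ x := by rintro rfl; tauto
    rcases hy1 with hcy | hyc
    · exact cfg_false hirr hD hs hab hbc hca hbx hxa (by tauto) (by tauto) nxc hcy (by tauto)
        (by tauto) ya yb yx
    · have := L hyc hca hxa ya yx nxc.symm
      tauto
  · have := L hca hab hxb nbc.symm nxc.symm nxa.symm
    tauto

/-- `K` is a strong clique. -/
def SC (A : V → V → Prop) (K : Set V) : Prop :=
  (∀ u ∈ K, ∀ v ∈ K, u ≠ v → (A u v ∨ A v u)) ∧ StrongOn A K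

lemma strongOn_of {K : Set V} (a : V)
    (h : ∀ v ∈ K, Relation.ReflTransGen (ArcOn A K) v a ∧ Relation.ReflTransGen (ArcOn A K) a v) :
    StrongOn A K := fun u hu v hv => (h u hu).1.trans (h v hv).2

lemma arcOn_mono {K K' : Set V} (h : K ⊆ K') {u v : V}
    (hr : Relation.ReflTransGen (ArcOn A K) u v) : Relation.ReflTransGen (ArcOn A K') u v :=
  hr.lift id (fun _ _ hh => ⟨h hh.1, h hh.2.1, hh.2.2⟩)

lemma clique_adj (hirr : Irreflexive A) (hD : ArcLocallyIn A)
    (hs : ∀ u v, Relation.ReflTransGen A u v)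
    (hdom : ∀ u v, u ≠ v → ¬ (A u v ∨ A v u) → ∃ w, (A u w ∨ A w u) ∧ ¬ (A v w ∨ A w v))
    {K : Set V} (hK : SC A K) (h3 : ∀ u v, ∃ w ∈ K, w ≠ u ∧ w ≠ v) {x u : V} (hx : x ∉ K)
    (hu : u ∈ K) (hxu : A x u) : ∀ w ∈ K, A x w ∨ A w x := by
  have irr : ∀ u v, A u v → u ≠ v := by rintro u v h rfl; exact hirr _ h
  have L := @ali V A hirr hD
  have T := @tri_adj V A hirr hD hs hdom
  obtain ⟨hcl, hst⟩ := hK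
  by_contra hcon
  push Not at hcon
  obtain ⟨w0, hw0, hw0x⟩ := hcon
  obtain ⟨w, r, hw, hr, hwK, hrK, hwr⟩ := cross (fun v => A x v ∨ A v x) (hst w0 hw0 u hu)
    (by tauto) (by tauto)
  have nK : ∀ v ∈ K, x ≠ v := by rintro v hv rfl; exact hx hv
  by_cases hxr : A x r
  · clear hw0x hw0 hxu hu u hr
    -- w → r ← x
    have nwr := irr _ _ hwr
    have f1 : ∀ y ∈ K, A y r → ¬ A w y := by
      intro y hy hyr hwy
      have := L hwy hyr hxr nwr (nK w hwK).symm (nK y hy).symm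
      tauto
    have f2 : ∀ y ∈ K, A y w → ¬ A r y := by
      intro y hy hyw hry
      have := (T hry hyw hwr hxr (nK y hy) (nK w hwK)).2
      tauto
    have f3 : ∀ y2 ∈ K, ∀ y1 ∈ K, A y2 y1 → A y1 r → A y1 w → A r y2 → A w y2 → False := by
      intro y2 h2 y1 h1 h21 h1r h1w hr2 hw2
      have t1 := T hr2 h21 h1r hxr (nK _ h2) (nK _ h1)
      have n2 : ¬ A x y2 := by
        intro h
        have := (T h21 h1w hw2 h (nK _ h1) (nK _ hwK)).2
        tauto
      have h2x : A y2 x := by tauto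
      have := (T hr2 h2x hxr hwr (irr _ _ hw2) (nK _ hwK).symm).2
      tauto
    by_cases hY : ∃ y ∈ K, y ≠ w ∧ A y r
    · obtain ⟨y, hyK, hyw, hyr⟩ := hY
      obtain ⟨s, t, hs', ⟨ht1, ht2⟩, hsK, htK, hst'⟩ := cross (fun y => y ≠ w ∧ A y r)
        (hst r hrK y hyK) (fun h => hirr _ h.2) ⟨hyw, hyr⟩
      have htw : A t w := by
        have := hcl t htK w hwK ht1
        have := f1 t htK ht2
        tauto
      have nrt := f2 t htK htw
      have nwt := f1 t htK ht2
      have nsr : s ≠ r := by rintro rfl; tauto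
      have nsw : s ≠ w := by rintro rfl; tauto
      have hsr : ¬ A s r := fun h => hs' ⟨nsw, h⟩
      have hrs : A r s := by
        have := hcl s hsK r hrK nsr
        tauto
      have hsw : ¬ A s w := fun h => f2 s hsK h hrs
      have hws : A w s := by
        have := hcl s hsK w hwK nsw
        tauto
      exact f3 s hsK t htK hst' ht2 htw hrs hws
    · push Not at hY
      obtain ⟨y, hyK, hyw, hyr⟩ := h3 w r
      obtain ⟨s, t, hs', ht, hsK, htK, hst'⟩ := cross (fun y => y = w ∨ y = r)
        (hst y hyK r hrK) (by tauto) (by tauto)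
      push Not at hs'
      have nsr := hY s hsK hs'.1
      have hrs : A r s := by
        have := hcl s hsK r hrK hs'.2
        tauto
      have hsw : ¬ A s w := fun h => f2 s hsK h hrs
      rcases ht with rfl | rfl <;> tauto
  · have hrx : A r x := by tauto
    have nru : r ≠ u := by rintro rfl; tauto
    have n1 : ¬ A r u := by
      intro h
      have := L hwr h hxu (by rintro rfl; tauto) (nK w hwK).symm (nK r hrK).symm
      tauto
    have hur : A u r := by
      have := hcl r hrK u hu nru
      tauto
    have := (T hrx hxu hur hwr (nK w hwK).symm (by rintro rfl; tauto)).1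
    tauto

lemma semicomplete [Finite V] (hirr : Irreflexive A) (hD : ArcLocallyIn A)
    (hs : ∀ u v, Relation.ReflTransGen A u v)
    (hdom : ∀ u v, u ≠ v → ¬ (A u v ∨ A v u) → ∃ w, (A u w ∨ A w u) ∧ ¬ (A v w ∨ A w v))
    {a b c : V} (hab : A a b) (hbc : A b c) (hca : A c a) :
    ∀ u v, u ≠ v → (A u v ∨ A v u) := by
  have irr : ∀ u v, A u v → u ≠ v := by rintro u v h rfl; exact hirr _ h
  have L := @ali V A hirr hD
  have nab := irr _ _ hab
  have nbc := irr _ _ hbc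
  have nca := irr _ _ hca
  have h0 : SC A {a, b, c} := by
    constructor
    · intro u hu v hv huv
      simp only [Set.mem_insert_iff, Set.mem_singleton_iff] at hu hv
      rcases hu with rfl | rfl | rfl <;> rcases hv with rfl | rfl | rfl <;> tauto
    · have e1 : ArcOn A {a, b, c} a b := ⟨by simp, by simp, hab⟩
      have e2 : ArcOn A {a, b, c} b c := ⟨by simp, by simp, hbc⟩
      have e3 : ArcOn A {a, b, c} c a := ⟨by simp, by simp, hca⟩
      refine strongOn_of a ?_
      intro v hv
      simp only [Set.mem_insert_iff, Set.mem_singleton_iff] at hv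
      rcases hv with rfl | rfl | rfl
      · exact ⟨.refl, .refl⟩
      · exact ⟨.head e2 (.single e3), .single e1⟩
      · exact ⟨.single e3, .head e1 (.single e2)⟩
  obtain ⟨K, hsub, hKmax⟩ := (Set.toFinite {K : Set V | SC A K}).exists_le_maximal h0
  have hK : SC A K := hKmax.prop
  have hmax : ∀ K', SC A K' → K ⊆ K' → K' ⊆ K := fun K' h1 h2 => hKmax.le_of_ge h1 h2
  have haK : a ∈ K := hsub (by simp)
  have hbK : b ∈ K := hsub (by simp)
  have hcK : c ∈ K := hsub (by simp)
  have h3 : ∀ u v, ∃ w ∈ K, w ≠ u ∧ w ≠ v := by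
    intro u v
    by_contra h
    push Not at h
    have h1 := h a haK
    have h2 := h b hbK
    have h3 := h c hcK
    clear h hmax hKmax hsub h0 L irr hdom hs hD hirr
    by_cases ha : a = u
    · subst ha
      exact nbc ((h2 nab.symm).trans (h3 nca).symm)
    · by_cases hb : b = u
      · subst hb
        exact nca ((h3 nbc.symm).trans (h1 ha).symm)
      · exact nab ((h1 ha).trans (h2 hb).symm)
  have CA := @clique_adj V A hirr hD hs hdom K hK h3
  have hall : ∀ z, z ∈ K := by
    by_contra hz
    push Not at hz
    obtain ⟨z, hz⟩ := hz
    obtain ⟨x, u, hx, hu, hxu⟩ := cross (fun v => v ∈ K) (hs z a) hz haK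
    -- no arcs from K to a dominating vertex
    have nok : ∀ x, x ∉ K → (∃ u ∈ K, A x u) → ∀ k ∈ K, ¬ A k x := by
      rintro x hx ⟨u, hu, hxu⟩ k hk hkx
      apply hx
      refine hmax (insert x K) ⟨?_, ?_⟩ (Set.subset_insert _ _) (Set.mem_insert _ _)
      · intro p hp q hq hpq
        rcases hp with rfl | hp <;> rcases hq with rfl | hq
        · exact absurd rfl hpq
        · exact CA hx hu hxu q hq
        · exact (CA hx hu hxu p hp).symm
        · exact hK.1 p hp q hq hpq
      · have m := @arcOn_mono V A K (insert x K) (Set.subset_insert _ _)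
        refine strongOn_of a ?_
        rintro v (rfl | hv)
        · exact ⟨.head ⟨Set.mem_insert _ _, Set.mem_insert_of_mem _ hu, hxu⟩ (m (hK.2 u hu a haK)),
            .tail (m (hK.2 a haK k hk)) ⟨Set.mem_insert_of_mem _ hk, Set.mem_insert _ _, hkx⟩⟩
        · exact ⟨m (hK.2 v hv a haK), m (hK.2 a haK v hv)⟩
    obtain ⟨y, x', hy, ⟨hx'K, u', hu', hxu'⟩, hyx'⟩ := cross (fun v => v ∉ K ∧ ∃ u ∈ K, A v u)
      (hs a x) (fun h => h.1 haK) ⟨hx, u, hu, hxu⟩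
    have hyK : y ∉ K := fun h => nok x' hx'K ⟨u', hu', hxu'⟩ y h hyx'
    have hyn : ∀ k ∈ K, ¬ A y k := fun k hk h => hy ⟨hyK, k, hk, h⟩
    have hxall : ∀ k ∈ K, A x' k := by
      intro k hk
      have := CA hx'K hu' hxu' k hk
      have := nok x' hx'K ⟨u', hu', hxu'⟩ k hk
      tauto
    have hky : ∀ k ∈ K, A k y := by
      intro k hk
      obtain ⟨w, hw, hwk, -⟩ := h3 k k
      obtain ⟨l, -, hl, hkl⟩ := first_step (hK.2 k hk w hw) hwk.symm
      have := L hyx' (hxall l hl) hkl (by rintro rfl; tauto) (by rintro rfl; tauto)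
        (by rintro rfl; tauto)
      have := hyn k hk
      tauto
    apply hyK
    have hsub' : K ⊆ insert x' (insert y K) := fun k hk => Or.inr (Or.inr hk)
    refine hmax (insert x' (insert y K)) ⟨?_, ?_⟩ hsub' (by simp)
    · have c1 := hK.1
      intro p hp q hq hpq
      rcases hp with rfl | rfl | hp <;> rcases hq with rfl | rfl | hq
      · exact absurd rfl hpq
      · exact Or.inr hyx'
      · exact Or.inl (hxall q hq)
      · exact Or.inl hyx'
      · exact absurd rfl hpq
      · exact Or.inr (hky q hq)
      · exact Or.inr (hxall p hp)
      · exact Or.inl (hky p hp)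
      · exact hK.1 p hp q hq hpq
    · have m := @arcOn_mono V A K _ hsub'
      have e1 : ArcOn A (insert x' (insert y K)) a y := ⟨hsub' haK, by simp, hky a haK⟩
      have e2 : ArcOn A (insert x' (insert y K)) y x' := ⟨by simp, by simp, hyx'⟩
      have e3 : ArcOn A (insert x' (insert y K)) x' a := ⟨by simp, hsub' haK, hxall a haK⟩
      refine strongOn_of a ?_
      rintro v (rfl | rfl | hv)
      · exact ⟨.single e3, .head e1 (.single e2)⟩
      · exact ⟨.head e2 (.single e3), .single e1⟩
      · exact ⟨m (hK.2 v hv a haK), m (hK.2 a haK v hv)⟩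
  exact fun u v huv => hK.1 u (hall u) v (hall v) huv

end Strong


section Walks

variable {V : Type*} {A : V → V → Prop}

/-- Directed walks of given length. -/
def Wk (A : V → V → Prop) : ℕ → V → V → Prop
  | 0, u, v => u = v
  | n + 1, u, v => ∃ w, A u w ∧ Wk A n w v

lemma Wk.add {m n : ℕ} {u v w : V} (h : Wk A m u v) (h' : Wk A n v w) : Wk A (m + n) u w := by
  induction m generalizing u with
  | zero =>
    have : u = v := h
    subst this
    simpa using h'
  | succ m ih =>
    obtain ⟨x, hx, h⟩ := h
    rw [show m + 1 + n = (m + n) + 1 by omega]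
    exact ⟨x, hx, ih h⟩

lemma Wk.one {u v : V} (h : A u v) : Wk A 1 u v := ⟨v, h, rfl⟩

lemma exists_wk {u v : V} (h : Relation.ReflTransGen A u v) : ∃ n, Wk A n u v := by
  induction h with
  | refl => exact ⟨0, rfl⟩
  | tail _ h ih =>
    obtain ⟨n, hn⟩ := ih
    exact ⟨n + 1, hn.add (Wk.one h)⟩

lemma Wk.fn {n : ℕ} {u v : V} (h : Wk A n u v) :
    ∃ p : ℕ → V, p 0 = u ∧ p n = v ∧ ∀ i < n, A (p i) (p (i + 1)) := by
  induction n generalizing u with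
  | zero => exact ⟨fun _ => u, rfl, h, by simp⟩
  | succ n ih =>
    obtain ⟨w, hw, h⟩ := h
    obtain ⟨p, h0, hn, hp⟩ := ih h
    refine ⟨fun i => Nat.casesOn i u p, rfl, hn, ?_⟩
    rintro (_ | i) hi
    · simpa [h0] using hw
    · exact hp i (by omega)

/-- A shortest odd closed walk gives a triangle or an induced odd cycle. -/
lemma odd_walk (hirr : Irreflexive A) (hD : ArcLocallyIn A)
    (hno : ¬ ∃ (n : ℕ) (c : ZMod n → V), Odd n ∧ 5 ≤ n ∧ Function.Injective c ∧
        (∀ i : ZMod n, A (c i) (c (i + 1))) ∧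
        (∀ i j : ZMod n, A (c i) (c j) → j = i + 1))
    (hodd : ∃ n u, Odd n ∧ Wk A n u u) : ∃ a b c, A a b ∧ A b c ∧ A c a := by
  classical
  have L := @ali V A hirr hD
  have hodd' : ∃ n, Odd n ∧ ∃ u, Wk A n u u := by
    obtain ⟨n, u, h1, h2⟩ := hodd
    exact ⟨n, h1, u, h2⟩
  obtain ⟨n, ⟨hn, u, hu⟩, hmin'⟩ : ∃ n, (Odd n ∧ ∃ u, Wk A n u u) ∧
      ∀ m < n, ¬ (Odd m ∧ ∃ u, Wk A m u u) :=
    ⟨Nat.find hodd', Nat.find_spec hodd', fun m hm => Nat.find_min hodd' hm⟩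
  have hmin : ∀ m u, m < n → Odd m → ¬ Wk A m u u := fun m u h1 h2 h3 => hmin' m h1 ⟨h2, u, h3⟩
  clear hmin' hodd' hodd
  obtain ⟨p, hp0, hpn, hp⟩ := hu.fn
  have hnpos : 0 < n := hn.pos
  let c : ℕ → V := fun i => p (i % n)
  have hper : ∀ i, c (i + n) = c i := by intro i; simp [c]
  have hc : ∀ i, A (c i) (c (i + 1)) := by
    intro i
    have h1 : i % n < n := Nat.mod_lt _ hnpos
    have h2 := hp (i % n) h1
    have h3 : c (i + 1) = p (i % n + 1) := by
      simp only [c]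
      rcases Nat.lt_or_ge (i % n + 1) n with h | h
      · rw [Nat.add_mod, Nat.mod_eq_of_lt (a := 1) (by omega), Nat.mod_eq_of_lt h]
      · have h4 : i % n + 1 = n := by omega
        have h5 : (i + 1) % n = 0 := by
          rw [← Nat.mod_add_mod, h4, Nat.mod_self]
        rw [h4, h5, hp0, hpn]
    rw [h3]
    exact h2
  have hw : ∀ m i, Wk A m (c i) (c (i + m)) := by
    intro m
    induction m with
    | zero => intro i; rfl
    | succ m ih =>
      intro i
      refine ⟨c (i + 1), hc i, ?_⟩
      have := ih (i + 1)
      rwa [show i + 1 + m = i + (m + 1) by omega] at this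
  have hback : ∀ i d, d ≤ n → Wk A (n - d) (c (i + d)) (c i) := by
    intro i d hd
    have := hw (n - d) (i + d)
    rwa [show i + d + (n - d) = i + n by omega, hper] at this
  have hinj : ∀ i d, 1 ≤ d → d < n → c i ≠ c (i + d) := by
    intro i d h1 h2 h
    rcases Nat.even_or_odd d with hd | hd
    · have := hback i d h2.le
      rw [h] at this
      exact hmin (n - d) _ (by omega) (Nat.Odd.sub_even h2.le hn hd) this
    · have := hw d i
      rw [← h] at this
      exact hmin d _ h2 hd this
  -- chords have even length
  have heven : ∀ i d, 2 ≤ d → d < n → A (c i) (c (i + d)) → Even d := by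
    intro i d h1 h2 h
    by_contra hd
    rw [Nat.not_even_iff_odd] at hd
    have h3 := (Wk.one h).add (hback i d h2.le)
    refine hmin _ _ ?_ ?_ h3
    · omega
    · exact Odd.add_even odd_one (Nat.Odd.sub_odd hn hd)
  -- adjacency
  have hn1 : n ≠ 1 := by
    rintro rfl
    have := hc 0
    rw [show (0 + 1) = 0 + 1 from rfl, hper] at this
    exact hirr _ this
  by_cases hn3 : n = 3
  · subst hn3
    refine ⟨c 0, c 1, c 2, hc 0, hc 1, ?_⟩
    have := hc 2
    rwa [show 2 + 1 = 0 + 3 from rfl, hper] at this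
  have hn5 : 5 ≤ n := by
    obtain ⟨k, rfl⟩ := hn
    omega
  exfalso
  -- no reverse arcs of odd type
  have hrev : ∀ i d, 2 ≤ d → d < n → Even d → d + 3 ≤ n → ¬ A (c (i + d)) (c i) := by
    intro i d h1 h2 hd h3 h
    have h4 : c i = c (i + d + (n - d)) := by
      rw [show i + d + (n - d) = i + n by omega, hper]
    rw [h4] at h
    have := heven (i + d) (n - d) (by omega) (by omega) h
    have h5 : Odd (n - d) := Nat.Odd.sub_even h2.le hn hd
    exact (Nat.not_even_iff_odd.mpr h5) this
  -- shift a chord backward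
  have hshift : ∀ i d, 2 ≤ d → d + 3 ≤ n → A (c (i + 1)) (c (i + 1 + d)) → A (c i) (c (i + d)) := by
    intro i d h1 h2 h
    have hd := heven _ d h1 (by omega) h
    have e1 : A (c (i + d)) (c (i + 1 + d)) := by
      have := hc (i + d)
      rwa [show i + d + 1 = i + 1 + d by omega] at this
    have := L (hc i) h e1 (by
      rw [show i + 1 + d = i + (d + 1) by omega]; exact hinj _ _ (by omega) (by omega))
      (hinj _ _ (by omega) (by omega)) (by
      rw [show i + d = i + 1 + (d - 1) by omega]; exact hinj _ _ (by omega) (by omega))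
    rcases this with h | h
    · exact h
    · exact absurd h (hrev i d h1 (by omega) hd h2)
  -- shorten a chord
  have hshort : ∀ i d, 4 ≤ d → d + 3 ≤ n → A (c i) (c (i + d)) → A (c i) (c (i + (d - 2))) := by
    intro i d h1 h2 h
    have hd := heven _ d (by omega) (by omega) h
    have hd2 : Even (d - 2) := by
      obtain ⟨k, rfl⟩ := hd
      exact ⟨k - 1, by omega⟩
    have e1 : A (c (i + (d - 2))) (c (i + (d - 1))) := by
      have := hc (i + (d - 2))
      rwa [show i + (d - 2) + 1 = i + (d - 1) by omega] at this
    have e2 : A (c (i + (d - 1))) (c (i + d)) := by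
      have := hc (i + (d - 1))
      rwa [show i + (d - 1) + 1 = i + d by omega] at this
    have := L e1 e2 h (by
      rw [show i + d = i + (d - 2) + 2 by omega]; exact hinj _ _ (by omega) (by omega))
      (hinj _ _ (by omega) (by omega)).symm (hinj _ _ (by omega) (by omega)).symm
    rcases this with h | h
    · exact absurd h (hrev i (d - 2) (by omega) (by omega) hd2 (by omega))
    · exact h
  have hshifts : ∀ j i d, 2 ≤ d → d + 3 ≤ n → A (c (i + j)) (c (i + j + d)) →
      A (c i) (c (i + d)) := by
    intro j
    induction j with
    | zero => intro i d _ _ h; exact h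
    | succ j ih =>
      intro i d h1 h2 h
      exact ih i d h1 h2 (hshift (i + j) d h1 h2 h)
  have hno2 : ∀ i, ¬ A (c i) (c (i + 2)) := by
    intro i h
    -- shift to i and i+2
    have h2 : A (c (i + 2)) (c (i + 2 + 2)) := by
      apply hshifts (n - 2) (i + 2) 2 le_rfl (by omega)
      rw [show i + 2 + (n - 2) = i + n by omega, hper,
        show i + n + 2 = i + 2 + n by omega, hper]
      exact h
    have h3 := ((Wk.one h).add (Wk.one h2)).add (hback i 4 (by omega))
    refine hmin _ _ ?_ ?_ h3
    · omega
    · exact Even.add_odd (by decide) (Nat.Odd.sub_even (by omega) hn (by decide))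
  have hnoch : ∀ d i, 2 ≤ d → d + 3 ≤ n → ¬ A (c i) (c (i + d)) := by
    intro d
    induction d using Nat.strong_induction_on with
    | _ d ih =>
      intro i h1 h2 h
      have hd := heven _ d h1 (by omega) h
      rcases Nat.lt_or_ge d 4 with h4 | h4
      · have : d = 2 := by
          obtain ⟨k, rfl⟩ := hd
          omega
        subst this
        exact hno2 i h
      · exact ih (d - 2) (by omega) i (by omega) (by omega) (hshort i d h4 h2 h)
  have hnodig : ∀ i, ¬ A (c (i + 3)) (c (i + 2)) := by
    intro i h
    have := L (hc i) (hc (i + 1)) h (hinj i 2 (by omega) (by omega))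
      (hinj _ _ (by omega) (by omega)) (by
        rw [show i + 3 = i + 1 + 2 by omega]; exact hinj _ _ (by omega) (by omega))
    rcases this with h' | h'
    · have := heven i 3 (by omega) (by omega) h'
      revert this; decide
    · have h4 : c i = c (i + 3 + (n - 3)) := by
        rw [show i + 3 + (n - 3) = i + n by omega, hper]
      rw [h4] at h'
      exact hnoch (n - 3) (i + 3) (by omega) (by omega) h'
  have hfin : ∀ i d, d < n → A (c i) (c (i + d)) → d = 1 := by
    intro i d h1 h
    by_contra hd
    rcases Nat.eq_zero_or_pos d with rfl | hd0
    · exact hirr _ h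
    have hev := heven i d (by omega) h1 h
    rcases Nat.lt_or_ge n (d + 3) with h3 | h3
    · have : d = n - 1 := by
        obtain ⟨k, rfl⟩ := hev
        obtain ⟨l, rfl⟩ := hn
        omega
      subst this
      apply hnodig (i + (n - 3))
      rw [show i + (n - 3) + 3 = i + n by omega, hper, show i + (n - 3) + 2 = i + (n - 1) by omega]
      exact h
    · exact hnoch d i (by omega) h3 h
  have : NeZero n := ⟨by omega⟩
  have : Fact (1 < n) := ⟨by omega⟩
  have hsucc : ∀ i : ZMod n, c ((i + 1).val) = c (i.val + 1) := by
    intro i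
    simp only [c]
    rw [ZMod.val_add, ZMod.val_one, Nat.mod_mod]
  have hgen : ∀ i j : ZMod n, c j.val = c (i.val + (j - i).val) := by
    intro i j
    simp only [c]
    rw [← ZMod.val_add, add_sub_cancel, Nat.mod_eq_of_lt (ZMod.val_lt j)]
  refine hno ⟨n, fun i => c i.val, hn, hn5, ?_, ?_, ?_⟩
  · intro i j hij
    by_contra hne
    have h1 := hgen i j
    have h2 : (j - i).val ≠ 0 := by
      rw [Ne, ZMod.val_eq_zero, sub_eq_zero]
      exact fun h => hne h.symm
    exact hinj i.val (j - i).val (by omega) (ZMod.val_lt _) (hij.trans h1)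
  · intro i
    simp only [hsucc]
    exact hc _
  · intro i j hij
    simp only [hgen i j] at hij
    have h1 := hfin i.val (j - i).val (ZMod.val_lt _) hij
    have h2 : j - i = 1 := by
      apply ZMod.val_injective n
      rw [h1, ZMod.val_one]
    rw [← h2]; ring

lemma bip (hirr : Irreflexive A) (hs : ∀ u v, Relation.ReflTransGen A u v)
    (hodd : ¬ ∃ n u, Odd n ∧ Wk A n u u) (t : V) : (Underlying A).Colorable 2 := by
  classical
  have key : ∀ u v, A u v → ((∃ n, Even n ∧ Wk A n t u) ↔ ¬ ∃ n, Even n ∧ Wk A n t v) := by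
    intro u v huv
    constructor
    · rintro ⟨n, hn, h⟩ ⟨m, hm, h'⟩
      obtain ⟨l, hl⟩ := exists_wk (hs v t)
      rcases Nat.even_or_odd l with h1 | h1
      · exact hodd ⟨_, t, (hn.add_one).add_even h1, (h.add (Wk.one huv)).add hl⟩
      · exact hodd ⟨_, t, hm.add_odd h1, h'.add hl⟩
    · intro h
      obtain ⟨n, hn⟩ := exists_wk (hs t u)
      refine ⟨n, ?_, hn⟩
      by_contra h1
      rw [Nat.not_even_iff_odd] at h1
      exact h ⟨n + 1, h1.add_one, hn.add (Wk.one huv)⟩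
  refine ⟨SimpleGraph.Coloring.mk (fun v => if ∃ n, Even n ∧ Wk A n t v then (0 : Fin 2) else 1) ?_⟩
  intro u v huv
  rw [und_adj hirr] at huv
  rcases huv with h | h
  · have := key u v h
    by_cases h1 : ∃ n, Even n ∧ Wk A n t u
    · simp [if_pos h1, if_neg (this.mp h1)]
    · have h2 : ∃ n, Even n ∧ Wk A n t v := by
        by_contra h2
        exact h1 (this.mpr h2)
      simp [if_neg h1, if_pos h2]
  · have := key v u h
    by_cases h1 : ∃ n, Even n ∧ Wk A n t v
    · simp [if_pos h1, if_neg (this.mp h1)]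
    · have h2 : ∃ n, Even n ∧ Wk A n t u := by
        by_contra h2
        exact h1 (this.mpr h2)
      simp [if_neg h1, if_pos h2]

end Walks


section Main

/-- A terminal vertex is reachable from everywhere. -/
lemma exists_terminal {V : Type*} [Finite V] (A : V → V → Prop) (v : V) :
    ∃ t, Relation.ReflTransGen A v t ∧
      ∀ x, Relation.ReflTransGen A t x → Relation.ReflTransGen A x t := by
  classical
  obtain ⟨t, ht, hmin⟩ := Set.exists_min_image {t | Relation.ReflTransGen A v t}
    (fun t => {x | Relation.ReflTransGen A t x}.ncard) (Set.toFinite _) ⟨v, .refl⟩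
  refine ⟨t, ht, fun x hx => ?_⟩
  have h1 : {y | Relation.ReflTransGen A x y} ⊆ {y | Relation.ReflTransGen A t y} :=
    fun y hy => hx.trans hy
  have h2 := Set.eq_of_subset_of_ncard_le h1 (hmin x (ht.trans hx)) (Set.toFinite _)
  have : t ∈ {y | Relation.ReflTransGen A t y} := Relation.ReflTransGen.refl
  rw [← h2] at this
  exact this

/-- A nontrivial terminal component is everything. -/
lemma stepA {V : Type*} {A : V → V → Prop} (hirr : Irreflexive A) (hD : ArcLocallyIn A)
    (hind : ∀ S : Set V, S ≠ Set.univ → GoodG ((Underlying A).induce S))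
    (hdom : ∀ u v, u ≠ v → ¬ (A u v ∨ A v u) → ∃ w, (A u w ∨ A w u) ∧ ¬ (A v w ∨ A w v))
    (hng : ¬ GoodG (Underlying A))
    (t t' : V) (htt : A t t')
    (hter : ∀ x, Relation.ReflTransGen A t x → Relation.ReflTransGen A x t) :
    ∀ u v, Relation.ReflTransGen A u v := by
  have irr : ∀ u v, A u v → u ≠ v := by rintro u v h rfl; exact hirr _ h
  have L := @ali V A hirr hD
  let T : Set V := {x | Relation.ReflTransGen A t x}
  have htT : t ∈ T := Relation.ReflTransGen.refl
  have hst : ∀ u ∈ T, ∀ v ∈ T, Relation.ReflTransGen A u v := fun u hu v hv => (hter u hu).trans hv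
  have hcl : ∀ u ∈ T, ∀ v, A u v → v ∈ T := fun u hu v huv => Relation.ReflTransGen.tail hu huv
  have hout : ∀ u ∈ T, ∃ v ∈ T, A u v := by
    intro u hu
    by_cases h : u = t
    · subst h
      exact ⟨t', hcl _ hu _ htt, htt⟩
    · obtain ⟨x, hx⟩ := first_step (hst u hu t htT) h
      exact ⟨x, hcl _ hu _ hx, hx⟩
  have hev : ∀ v, v ∉ T → ∀ u ∈ T, A v u → ∀ m, ∀ w ∈ T, Wk A (2 * m) w u → A v w := by
    intro v hv u hu hvu m
    induction m with
    | zero =>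
      intro w hw h
      have : w = u := h
      rwa [this]
    | succ m ih =>
      intro w hw h
      rw [show 2 * (m + 1) = (2 * m + 1) + 1 by ring] at h
      obtain ⟨y, hwy, z, hyz, h⟩ := h
      have hy := hcl w hw y hwy
      have hz := hcl y hy z hyz
      have hvz := ih z hz h
      by_cases hwz : w = z
      · rwa [hwz]
      have := L hwy hyz hvz hwz (by rintro rfl; exact hv hw) (by rintro rfl; exact hv hy)
      rcases this with h | h
      · exact absurd (hcl w hw v h) hv
      · exact h
  let N : Set V := {v | v ∉ T ∧ ∃ u ∈ T, A v u}
  have hNT : ∀ v ∈ N, ∀ b ∈ T, A v b := by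
    rintro v ⟨hv, u, hu, hvu⟩ b hb
    by_contra hvb
    have hbv : ¬ A b v := fun h => hv (hcl b hb v h)
    have hodd : ∀ n, Wk A n b u → Odd n := by
      intro n hn
      by_contra h
      rw [Nat.not_odd_iff_even] at h
      obtain ⟨k, rfl⟩ := h
      rw [← two_mul] at hn
      exact hvb (hev v hv u hu hvu k b hb hn)
    have hvin : ∀ a ∈ T, A b a → A v a := by
      intro a ha hba
      obtain ⟨n, hn⟩ := exists_wk (hst a ha u hu)
      have h1 := hodd _ ((Wk.one hba).add hn)
      have h2 : Even n := by
        rcases Nat.even_or_odd n with h | h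
        · exact h
        · have := odd_one.add_odd h
          exact absurd h1 (Nat.not_odd_iff_even.mpr this)
      obtain ⟨k, rfl⟩ := h2
      rw [← two_mul] at hn
      exact hev v hv u hu hvu k a ha hn
    have hvin' : ∀ a ∈ T, A a b → A v a := by
      intro a ha hab
      obtain ⟨n, hn⟩ := exists_wk (hst b hb u hu)
      have h1 := hodd _ hn
      have h2 : Even (1 + n) := odd_one.add_odd h1
      obtain ⟨k, hk⟩ := h2
      have h3 := (Wk.one hab).add hn
      rw [hk, ← two_mul] at h3
      exact hev v hv u hu hvu k a ha h3
    obtain ⟨w, hw1, hw2⟩ := hdom b v (by rintro rfl; exact hv hb) (by tauto)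
    rcases hw1 with h | h
    · exact hw2 (Or.inl (hvin w (hcl b hb w h) h))
    · by_cases hwT : w ∈ T
      · exact hw2 (Or.inl (hvin' w hwT h))
      · obtain ⟨a, ha, hba⟩ := hout b hb
        have := L h hba (hvin a ha hba) (by rintro rfl; exact hwT ha) (by rintro rfl; exact hvb h)
          (by rintro rfl; exact hv hb)
        tauto
  have hNN : ∀ v ∈ N, ∀ w ∈ N, v ≠ w → (A v w ∨ A w v) := by
    intro v hv w hw hvw
    obtain ⟨a, ha, hta⟩ := hout t htT
    exact L (hNT v hv t htT) hta (hNT w hw a ha) (by rintro rfl; exact hv.1 ha) hvw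
      (by rintro rfl; exact hw.1 htT)
  -- no other vertices
  have h1 : ∀ z, z ∈ T ∨ z ∈ N := by
    by_contra hz
    push Not at hz
    obtain ⟨z, hz1, hz2⟩ := hz
    apply hng
    refine good_cut _ hind T N (fun x hx hx' => hx'.1 hx) ⟨t, htT⟩ ⟨z, hz1, hz2⟩ ?_ ?_
    · intro x hx y hy hxy
      rw [und_adj hirr]
      exact hNN x hx y hy hxy
    · intro x hx y hy1 hy2 h
      rw [und_adj hirr] at h
      rcases h with h | h
      · exact hy1 (hcl x hx y h)
      · exact hy2 ⟨hy1, x, hx, h⟩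
  have h2 : ∀ v, v ∉ N := by
    intro v hv
    apply hng
    refine good_stable _ hind {v} (by simp) ?_
    intro K _ hK
    refine ⟨v, rfl, fun x hx => ?_⟩
    rw [und_adj hirr]
    have hxv : x ≠ v := hK x hx
    rcases h1 x with h | h
    · exact Or.inl (hNT v hv x h)
    · exact hNN v hv x h hxv.symm
  have h3 : ∀ v, v ∈ T := fun v => (h1 v).resolve_right (h2 v)
  exact fun u v => hst u (h3 u) v (h3 v)

/-- All terminal components are sinks: the graph is a comparability graph. -/
lemma stepC {V : Type*} [Finite V] {A : V → V → Prop} (hirr : Irreflexive A) (hD : ArcLocallyIn A)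
    (hind : ∀ S : Set V, S ≠ Set.univ → GoodG ((Underlying A).induce S))
    (hdom : ∀ u v, u ≠ v → ¬ (A u v ∨ A v u) → ∃ w, (A u w ∨ A w u) ∧ ¬ (A v w ∨ A w v))
    (hV : Nonempty V)
    (hsink : ∀ t, (∀ x, Relation.ReflTransGen A t x → Relation.ReflTransGen A x t) →
      ∀ y, ¬ A t y) : GoodG (Underlying A) := by
  classical
  have irr : ∀ u v, A u v → u ≠ v := by rintro u v h rfl; exact hirr _ h
  have L := @ali V A hirr hD
  have hs : ∀ v, ∃ t, Relation.ReflTransGen A v t ∧ ∀ y, ¬ A t y := by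
    intro v
    obtain ⟨t, h1, h2⟩ := exists_terminal A v
    exact ⟨t, h1, hsink t h2⟩
  have hreach : ∀ t, (∀ y, ¬ A t y) → ∀ x, Relation.ReflTransGen A x t → x ≠ t → A x t := by
    intro t ht x hx
    induction hx using Relation.ReflTransGen.head_induction_on with
    | refl => exact fun h => absurd rfl h
    | @head x u hxu _ ih =>
      intro hxt
      by_cases hut : u = t
      · rwa [← hut]
      have hu := ih hut
      by_contra hn
      obtain ⟨w, hw1, hw2⟩ := hdom t x hxt.symm (by have := ht x; tauto)
      have hwt : A w t := hw1.resolve_left (ht w)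
      have hxw : x ≠ w := by rintro rfl; exact hn hwt
      have huw : u ≠ w := by rintro rfl; tauto
      exact hw2 (L hxu hu hwt hxt hxw huw)
  have hcomp : ∀ x y, Relation.ReflTransGen A x y → x ≠ y → (A x y ∨ A y x) := by
    intro x y hxy hne
    obtain ⟨t, hyt, ht⟩ := hs y
    by_cases hy : y = t
    · subst hy
      exact Or.inl (hreach y ht x hxy hne)
    · obtain h | ⟨x', hxx', hx'y⟩ := Relation.ReflTransGen.cases_head hxy
      · exact absurd h hne
      by_cases hx' : x' = y
      · subst hx'; exact Or.inl hxx'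
      have hx't : x' ≠ t := by
        rintro rfl
        obtain ⟨z, hz⟩ := first_step hx'y hx'
        exact ht z hz
      have hxt : x ≠ t := by
        rintro rfl
        exact ht _ hxx'
      exact L hxx' (hreach t ht x' (hx'y.trans hyt) hx't) (hreach t ht y hyt hy) hxt hne hx'
  refine good_stable _ hind {t | ∀ y, ¬ A t y} ?_ ?_
  · intro u hu v hv h
    rw [und_adj hirr] at h
    exact h.elim (hu v) (hv u)
  · intro K hK hKM
    rcases K.eq_empty_or_nonempty with rfl | hne
    · obtain ⟨v⟩ := hV
      obtain ⟨t, -, ht⟩ := hs v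
      exact ⟨t, ht, by simp⟩
    obtain ⟨k, hk, hmax⟩ := K.exists_max_image
      (fun k => {x | Relation.ReflTransGen A x k}.ncard) hne
    have hall : ∀ j ∈ K, Relation.ReflTransGen A j k := by
      intro j hj
      by_cases hjk : j = k
      · rw [hjk]
      have hadj := hK hj hk hjk
      rw [und_adj hirr] at hadj
      rcases hadj with h | h
      · exact .single h
      · have h1 : {x | Relation.ReflTransGen A x k} ⊆ {x | Relation.ReflTransGen A x j} :=
          fun x hx => Relation.ReflTransGen.tail hx h
        have h2 := Set.eq_of_subset_of_ncard_le h1 (hmax j hj) (Set.toFinite _)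
        have : j ∈ {x | Relation.ReflTransGen A x j} := Relation.ReflTransGen.refl
        rw [← h2] at this
        exact this
    obtain ⟨t, hkt, ht⟩ := hs k
    refine ⟨t, ht, fun x hx => ?_⟩
    rw [und_adj hirr]
    have hxt : x ≠ t := by
      rintro rfl
      exact hKM x hx ht
    exact Or.inr (hreach t ht x ((hall x hx).trans hkt) hxt)

lemma key_step {V : Type*} [Finite V] {A : V → V → Prop} (hirr : Irreflexive A)
    (hD : ArcLocallyIn A)
    (hno : ¬ ∃ (n : ℕ) (c : ZMod n → V), Odd n ∧ 5 ≤ n ∧ Function.Injective c ∧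
        (∀ i : ZMod n, A (c i) (c (i + 1))) ∧
        (∀ i j : ZMod n, A (c i) (c j) → j = i + 1))
    (hind : ∀ S : Set V, S ≠ Set.univ → GoodG ((Underlying A).induce S)) :
    GoodG (Underlying A) := by
  classical
  by_contra hng
  have hdom : ∀ u v, u ≠ v → ¬ (A u v ∨ A v u) →
      ∃ w, (A u w ∨ A w u) ∧ ¬ (A v w ∨ A w v) := by
    intro u v huv hn
    by_contra h
    push Not at h
    apply hng
    refine good_dom _ hind u v huv (by rwa [und_adj hirr]) ?_
    intro w hw
    rw [und_adj hirr] at hw ⊢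
    have := h w hw
    tauto
  have hV : Nonempty V := by
    by_contra hV
    rw [not_nonempty_iff] at hV
    exact hng fun k _ => SimpleGraph.Colorable.of_isEmpty _
  by_cases hex : ∃ t, (∀ x, Relation.ReflTransGen A t x → Relation.ReflTransGen A x t) ∧
      ∃ y, A t y
  · obtain ⟨t, hter, t', htt⟩ := hex
    have hs := stepA hirr hD hind hdom hng t t' htt hter
    by_cases hodd : ∃ n u, Odd n ∧ Wk A n u u
    · obtain ⟨a, b, c, hab, hbc, hca⟩ := odd_walk hirr hD hno hodd
      have hall := semicomplete hirr hD hs hdom hab hbc hca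
      apply hng
      refine good_stable _ hind {t} (by simp) ?_
      intro K _ hK
      refine ⟨t, rfl, fun x hx => ?_⟩
      rw [und_adj hirr]
      exact hall t x (fun h => hK x hx h.symm)
    · apply hng
      intro k hk
      have h2 := bip hirr hs hodd t
      refine h2.mono ?_
      by_contra hlt
      have hk2 : (Underlying A).CliqueFree 2 := hk.mono (by omega)
      rw [SimpleGraph.cliqueFree_two] at hk2
      have : (Underlying A).Adj t t' := by rw [und_adj hirr]; exact Or.inl htt
      rw [hk2] at this
      exact this
  · push Not at hex
    exact hng (stepC hirr hD hind hdom hV hex)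

lemma key (n : ℕ) : ∀ {V : Type*} [Finite V] {A : V → V → Prop}, Nat.card V = n →
    Irreflexive A → ArcLocallyIn A →
    (¬ ∃ (n : ℕ) (c : ZMod n → V), Odd n ∧ 5 ≤ n ∧ Function.Injective c ∧
        (∀ i : ZMod n, A (c i) (c (i + 1))) ∧
        (∀ i j : ZMod n, A (c i) (c j) → j = i + 1)) → GoodG (Underlying A) := by
  induction n using Nat.strong_induction_on with
  | _ n ih =>
    intro V _ A hcard hirr hD hno
    refine key_step hirr hD hno ?_
    intro S hS
    have hlt : Nat.card S < n := by
      rw [← hcard]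
      have := Set.ncard_lt_ncard (Set.ssubset_univ_iff.mpr hS) (Set.toFinite _)
      rwa [Set.ncard_univ, ← Nat.card_coe_set_eq] at this
    have := ih _ hlt (V := S) (A := fun x y => A x y) rfl (fun x => hirr x) (by
      intro v1 v2 v3 v4 h12 h13 h14 h23 h24 h34 a1 a2 a3
      exact hD v1 v2 v3 v4 (Subtype.coe_ne_coe.mpr h12) (Subtype.coe_ne_coe.mpr h13)
        (Subtype.coe_ne_coe.mpr h14) (Subtype.coe_ne_coe.mpr h23) (Subtype.coe_ne_coe.mpr h24)
        (Subtype.coe_ne_coe.mpr h34) a1 a2 a3) (by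
      rintro ⟨m, c, h1, h2, h3, h4, h5⟩
      exact hno ⟨m, fun i => c i, h1, h2, Subtype.val_injective.comp h3, h4, h5⟩)
    have heq : (Underlying A).induce S = Underlying (fun x y : S => A x y) := by
      ext x y
      exact (und_adj hirr).trans (und_adj (A := fun x y : S => A x y) (fun x => hirr x)).symm
    rw [heq]
    exact this

lemma good_imp {V : Type*} [Finite V] {G : SimpleGraph V} (h : GoodG G) :
    G.chromaticNumber = (G.cliqueNum : ℕ∞) := by
  apply le_antisymm
  · apply SimpleGraph.Colorable.chromaticNumber_le
    apply h
    intro s hs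
    have := SimpleGraph.IsClique.card_le_cliqueNum (tc := hs.1)
    rw [hs.2] at this
    omega
  · exact SimpleGraph.cliqueNum_le_chromaticNumber

lemma good_induce {V : Type*} [Finite V] {A : V → V → Prop} (hirr : Irreflexive A)
    (hD : ArcLocallyIn A)
    (hno : ¬ ∃ (n : ℕ) (c : ZMod n → V), Odd n ∧ 5 ≤ n ∧ Function.Injective c ∧
        (∀ i : ZMod n, A (c i) (c (i + 1))) ∧
        (∀ i j : ZMod n, A (c i) (c j) → j = i + 1)) (S : Set V) :
    GoodG ((Underlying A).induce S) := by
  have := key (Nat.card S) (V := S) (A := fun x y => A x y) rfl (fun x => hirr x) (by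
      intro v1 v2 v3 v4 h12 h13 h14 h23 h24 h34 a1 a2 a3
      exact hD v1 v2 v3 v4 (Subtype.coe_ne_coe.mpr h12) (Subtype.coe_ne_coe.mpr h13)
        (Subtype.coe_ne_coe.mpr h14) (Subtype.coe_ne_coe.mpr h23) (Subtype.coe_ne_coe.mpr h24)
        (Subtype.coe_ne_coe.mpr h34) a1 a2 a3) (by
      rintro ⟨m, c, h1, h2, h3, h4, h5⟩
      exact hno ⟨m, fun i => c i, h1, h2, Subtype.val_injective.comp h3, h4, h5⟩)
  have heq : (Underlying A).induce S = Underlying (fun x y : S => A x y) := by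
    ext x y
    exact (und_adj hirr).trans (und_adj (A := fun x y : S => A x y) (fun x => hirr x)).symm
  rw [heq]
  exact this

lemma cycle_imperfect {V : Type*} [Finite V] {A : V → V → Prop} (hirr : Irreflexive A)
    (hP : Diperfect A) {n : ℕ} {c : ZMod n → V} (hn : Odd n) (h5 : 5 ≤ n)
    (harc : ∀ i : ZMod n, A (c i) (c (i + 1)))
    (hind : ∀ i j : ZMod n, A (c i) (c j) → j = i + 1) : False := by
  classical
  have h := hP (Set.range c)
  set H := (Underlying A).induce (Set.range c) with hH
  have hadj : ∀ x y, H.Adj x y ↔ (A x y ∨ A y x) := by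
    intro x y
    rw [hH, SimpleGraph.comap_adj, und_adj hirr]
    rfl
  have hle : H.cliqueNum ≤ 2 := by
    by_contra hlt
    obtain ⟨s, hs⟩ := H.exists_isNClique_cliqueNum
    have h3 : 2 < s.card := by rw [hs.2]; omega
    obtain ⟨⟨_, i, rfl⟩, ⟨_, j, rfl⟩, ⟨_, k, rfl⟩, hi, hj, hk, hij, hik, hjk⟩ :=
      Finset.two_lt_card_iff.mp h3
    have a1 := (hadj _ _).mp (hs.1 hi hj hij)
    have a2 := (hadj _ _).mp (hs.1 hi hk hik)
    have a3 := (hadj _ _).mp (hs.1 hj hk hjk)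
    have b1 : j = i + 1 ∨ i = j + 1 := a1.imp (hind _ _) (hind _ _)
    have b2 : k = i + 1 ∨ i = k + 1 := a2.imp (hind _ _) (hind _ _)
    have b3 : k = j + 1 ∨ j = k + 1 := a3.imp (hind _ _) (hind _ _)
    have n1 : ((1 : ℕ) : ZMod n) ≠ 0 := by
      rw [Ne, ZMod.natCast_eq_zero_iff]
      intro h; have := Nat.le_of_dvd (by omega) h; omega
    have n3 : ((3 : ℕ) : ZMod n) ≠ 0 := by
      rw [Ne, ZMod.natCast_eq_zero_iff]
      intro h; have := Nat.le_of_dvd (by omega) h; omega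
    push_cast at n1 n3
    rcases b1 with b1 | b1 <;> rcases b2 with b2 | b2 <;> rcases b3 with b3 | b3 <;>
      first
      | (apply n1; linear_combination b1 + b2 + b3)
      | (apply n1; linear_combination b1 + b2 - b3)
      | (apply n1; linear_combination b1 - b2 + b3)
      | (apply n1; linear_combination b1 - b2 - b3)
      | (apply n1; linear_combination -b1 + b2 + b3)
      | (apply n1; linear_combination -b1 + b2 - b3)
      | (apply n1; linear_combination -b1 - b2 + b3)
      | (apply n1; linear_combination -b1 - b2 - b3)
      | (apply n3; linear_combination b1 + b2 + b3)
      | (apply n3; linear_combination b1 + b2 - b3)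
      | (apply n3; linear_combination b1 - b2 + b3)
      | (apply n3; linear_combination b1 - b2 - b3)
      | (apply n3; linear_combination -b1 + b2 + b3)
      | (apply n3; linear_combination -b1 + b2 - b3)
      | (apply n3; linear_combination -b1 - b2 + b3)
      | (apply n3; linear_combination -b1 - b2 - b3)
  have hcol : H.Colorable 2 := by
    rw [← SimpleGraph.chromaticNumber_le_iff_colorable, h]
    exact_mod_cast hle
  obtain ⟨C⟩ := hcol
  let g : ℕ → Fin 2 := fun i => C ⟨c (i : ZMod n), Set.mem_range_self _⟩
  have hg : ∀ i, g i ≠ g (i + 1) := by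
    intro i
    apply C.valid
    rw [hadj]
    left
    have := harc (i : ZMod n)
    push_cast
    exact this
  have hg2 : ∀ k, g (2 * k) = g 0 := by
    intro k
    induction k with
    | zero => rfl
    | succ k ih =>
      have h1 := hg (2 * k)
      have h2 := hg (2 * k + 1)
      rw [show 2 * (k + 1) = 2 * k + 1 + 1 by ring]
      omega
  obtain ⟨k, hk⟩ := hn
  have h1 := hg (2 * k)
  rw [hg2, ← hk] at h1
  apply h1
  simp [g]

end Main

end ALI

/-- An arc-locally in-semicomplete digraph is diperfect iff it
contains no induced directed odd cycle of length at least five. -/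
theorem stmt_3 {V : Type*} [Fintype V] (A : V → V → Prop) (hirr : Irreflexive A)
    (hD : ArcLocallyIn A) :
    Diperfect A ↔
      ¬ ∃ (n : ℕ) (c : ZMod n → V), Odd n ∧ 5 ≤ n ∧ Function.Injective c ∧
        (∀ i : ZMod n, A (c i) (c (i + 1))) ∧
        (∀ i j : ZMod n, A (c i) (c j) → j = i + 1) := by
  constructor
  · rintro hP ⟨n, c, hn, h5, -, harc, hind⟩
    exact ALI.cycle_imperfect hirr hP hn h5 harc hind
  · intro hno S
    exact ALI.good_imp (ALI.good_induce hirr hD hno S)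
end

section
/- Let D be a connected arc-locally in-semicomplete digraph. Then at least one of the following holds: (i) D is a diperfect digraph; (ii) V(D) can be partitioned into (V1,V2,V3) such that the subdigraph induced by V1 is semicomplete, every vertex of V1 dominates every vertex of V2 and there is no arc from V2 to V1, there is no arc from V3 to V1, the subdigraph induced by V2 is an odd extended cycle of length at least five, there is no arc from V3 to V2, the subdigraph induced by V3 is bipartite, and V1 or V3 (or both) may be empty; (iii) D has a clique cut. -/
variable {V : Type*}

/-! ### Induced directed cycles -/

/-- An induced directed cycle, indexed by a ring (to be `ZMod k`). -/
def DHole {R : Type*} [CommRing R] (A : V → V → Prop) (x : R → V) : Prop :=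
  ∀ i j, A (x i) (x j) ↔ j = i + 1

theorem ali {A : V → V → Prop} (hirr : ∀ x, ¬ A x x) (hD : ArcLocallyIn A) {a b c d : V}
    (h1 : A a b) (h2 : A b c) (h3 : A d c) (hac : a ≠ c) (had : a ≠ d) (hbd : b ≠ d) :
    DAdj A a d :=
  hD a b c d (fun h => hirr _ (h ▸ h1)) hac had (fun h => hirr _ (h ▸ h2)) hbd
    (fun h => hirr _ (h ▸ h3)) h1 h2 h3

theorem zm_ne {k : ℕ} (hk : 5 ≤ k) :
    (1 : ZMod k) ≠ 0 ∧ (2 : ZMod k) ≠ 0 ∧ (3 : ZMod k) ≠ 0 ∧ (4 : ZMod k) ≠ 0 := by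
  have key : ∀ n : ℕ, 1 ≤ n → n ≤ 4 → ((n : ℕ) : ZMod k) ≠ 0 := by
    intro n h1 h4 h
    rw [ZMod.natCast_eq_zero_iff] at h
    have := Nat.le_of_dvd (by omega) h
    omega
  refine ⟨?_, ?_, ?_, ?_⟩
  · simpa using key 1 (by norm_num) (by norm_num)
  · simpa using key 2 (by norm_num) (by norm_num)
  · simpa using key 3 (by norm_num) (by norm_num)
  · simpa using key 4 (by norm_num) (by norm_num)

theorem zm_half {k : ℕ} (hk : 5 ≤ k) (hodd : Odd k) (a : ZMod k) : ∃ n : ℕ, a = 2 * (n : ZMod k) := by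
  have : NeZero k := ⟨by omega⟩
  obtain ⟨m, hm⟩ := hodd
  refine ⟨a.val * (m + 1), ?_⟩
  have h0 : ((k : ℕ) : ZMod k) = 0 := ZMod.natCast_self k
  have h1 : (2 * (m : ZMod k) + 1) = 0 := by
    have h2 : ((2 * m + 1 : ℕ) : ZMod k) = 0 := by rw [← hm]; exact h0
    simpa using h2
  push_cast
  rw [ZMod.natCast_zmod_val]
  linear_combination (-a) * h1

/-- The arithmetic properties of `ZMod k`, for `k ≥ 5` odd, that are used. -/
structure GoodR (R : Type*) [CommRing R] : Prop where
  n1 : (1 : R) ≠ 0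
  n2 : (2 : R) ≠ 0
  n3 : (3 : R) ≠ 0
  n4 : (4 : R) ≠ 0
  half : ∀ a : R, ∃ n : ℕ, a = 2 * (n : R)

theorem goodR_zmod {k : ℕ} (hk : 5 ≤ k) (hodd : Odd k) : GoodR (ZMod k) :=
  ⟨(zm_ne hk).1, (zm_ne hk).2.1, (zm_ne hk).2.2.1, (zm_ne hk).2.2.2, zm_half hk hodd⟩

/-- The trace on an induced directed cycle of a clone of `x m`. -/
def CloneAt (A : V → V → Prop) {R : Type*} [CommRing R] (x : R → V) (m : R) (v : V) : Prop :=
  ∀ j, (A v (x j) ↔ j = m + 1) ∧ (A (x j) v ↔ j = m - 1)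

def DomAll (A : V → V → Prop) {R : Type*} [CommRing R] (x : R → V) (v : V) : Prop :=
  ∀ j, A v (x j) ∧ ¬ A (x j) v

section hole
variable {A : V → V → Prop} {R : Type*} [CommRing R] {x : R → V}

theorem DHole.inj (hx : DHole A x) {i j : R} (h : x i = x j) : i = j := by
  have h1 : A (x i) (x (j+1)) := by rw [h]; exact (hx j (j+1)).2 rfl
  have := (hx _ _).1 h1
  grind

theorem DHole.ne (hx : DHole A x) {i j : R} (h : i ≠ j) : x i ≠ x j :=
  fun e => h (hx.inj e)

theorem DHole.arc (hx : DHole A x) (i : R) : A (x i) (x (i+1)) := (hx _ _).2 rfl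

theorem DHole.arc' (hx : DHole A x) (i : R) : A (x (i-1)) (x i) := (hx _ _).2 (by ring)

theorem DHole.adj (hx : DHole A x) {i j : R} (h : DAdj A (x i) (x j)) :
    j = i + 1 ∨ i = j + 1 := by
  rcases h with h | h
  · exact Or.inl ((hx _ _).1 h)
  · exact Or.inr ((hx _ _).1 h)

theorem DHole.self_clone (hx : DHole A x) (m : R) : CloneAt A x m (x m) := by
  intro j
  refine ⟨hx _ _, (hx _ _).trans ?_⟩
  constructor <;> intro h <;> rw [h] <;> ring

theorem DHole.trace (hirr : ∀ x, ¬ A x x) (hD : ArcLocallyIn A) (hk : GoodR R)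
    (hx : DHole A x) {v : V} {i : R} (hv : A v (x i)) :
    DomAll A x v ∨ ∃ m, CloneAt A x m v := by
  obtain ⟨n1, n2, n3, n4, -⟩ := id hk
  by_cases hr : ∃ m, v = x m
  · obtain ⟨m, rfl⟩ := hr
    exact Or.inr ⟨m, hx.self_clone m⟩
  have hne : ∀ m, v ≠ x m := fun m h => hr ⟨m, h⟩
  have step : ∀ j, A v (x j) → A (x (j-2)) v ∨ A v (x (j-2)) := by
    intro j hj
    have a1 : A (x (j-2)) (x (j-1)) := (hx _ _).2 (by ring)
    have := ali hirr hD a1 (hx.arc' j) hj (hx.ne (fun h => n2 (by linear_combination -h))) (hne _).symm (hne _).symm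
    exact this
  by_cases hall : ∀ j, A v (x j) → A v (x (j-2))
  · left
    have h1 : ∀ n : ℕ, A v (x (i - 2 * (n : R))) := by
      intro n
      induction n with
      | zero => simpa using hv
      | succ n ih =>
        have := hall _ ih
        convert this using 2
        push_cast; ring
    have h2 : ∀ j, A v (x j) := by
      intro j
      obtain ⟨n, hn⟩ := hk.half (i - j)
      have := h1 n
      rw [← hn] at this
      simpa using this
    intro j
    refine ⟨h2 j, fun hj => ?_⟩
    have a1 : A (x (j+2)) (x (j+3)) := (hx _ _).2 (by ring)
    have := ali hirr hD hj (h2 (j+3)) a1 (hx.ne (fun h => n3 (by linear_combination -h))) (hx.ne (fun h => n2 (by linear_combination -h))) (hne _)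
    rcases hx.adj this with h | h
    · exact n1 (by linear_combination h)
    · exact n3 (by linear_combination -h)
  · push Not at hall
    obtain ⟨i, hi, hi2⟩ := hall
    have hin : A (x (i-2)) v := (step i hi).resolve_right hi2
    right
    refine ⟨i - 1, ?_⟩
    have hin_only : ∀ j, A (x j) v → j = i - 2 := by
      intro j hj
      by_contra hji
      have b1 : j = i - 3 ∨ j = i - 4 := by
        by_contra hb
        push Not at hb
        have a1 : A (x (i-3)) (x (i-2)) := (hx _ _).2 (by ring)
        have := ali hirr hD a1 hin hj (hne _).symm (hx.ne hb.1.symm) (hx.ne (Ne.symm hji))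
        rcases hx.adj this with h | h
        · exact hji (by linear_combination h)
        · exact hb.2 (by linear_combination -h)
      have b2 : j = i - 1 ∨ j = i := by
        by_contra hb
        push Not at hb
        have := ali hirr hD (hx.arc' j) hj hin (hne _).symm (hx.ne (fun h => hb.1 (by linear_combination h))) (hx.ne hji)
        rcases hx.adj this with h | h
        · exact hji (by linear_combination -h)
        · exact hb.2 (by linear_combination h)
      rcases b1 with b1 | b1 <;> rcases b2 with b2 | b2
      · exact n2 (by linear_combination b1 - b2)
      · exact n3 (by linear_combination b1 - b2)
      · exact n3 (by linear_combination b1 - b2)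
      · exact n4 (by linear_combination b1 - b2)
    have hno2 : ¬ A v (x (i+2)) := by
      intro h
      have a1 : A (x (i+1)) (x (i+2)) := (hx _ _).2 (by ring)
      have := ali hirr hD hin h a1 (hx.ne (fun h => n4 (by linear_combination -h))) (hx.ne (fun h => n3 (by linear_combination -h))) (hne _)
      rcases hx.adj this with h | h
      · exact n2 (by linear_combination h)
      · exact n4 (by linear_combination -h)
    have hout_only : ∀ j, A v (x j) → j = i := by
      intro j hj
      by_contra hji
      have h1 : ∀ n : ℕ, A v (x (j - 2 * (n : R))) ∧ j - 2 * (n : R) ≠ i := by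
        intro n
        induction n with
        | zero => exact ⟨by simpa using hj, by simpa using hji⟩
        | succ n ih =>
          have e : j - 2 * ((n + 1 : ℕ) : R) = j - 2 * (n : R) - 2 := by
            push_cast; ring
          rw [e]
          constructor
          · rcases step _ ih.1 with h | h
            · have := hin_only _ h
              exact absurd (by linear_combination this) ih.2
            · exact h
          · intro h
            apply hno2
            have : i + 2 = j - 2 * (n : R) := by linear_combination -h
            rw [this]
            exact ih.1
      obtain ⟨n, hn⟩ := hk.half (j - i)
      exact (h1 n).2 (by linear_combination hn)
    intro j
    refine ⟨⟨fun h => ?_, fun h => ?_⟩, ⟨fun h => ?_, fun h => ?_⟩⟩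
    · rw [hout_only j h]; ring
    · rw [h]; simpa using hi
    · rw [hin_only j h]; ring
    · rw [h]; convert hin using 2; ring

open Classical in
theorem DHole.swap (hirr : ∀ x, ¬ A x x) (hk : GoodR R)
    (hx : DHole A x) {v : V} {m : R} (hv : CloneAt A x m v) :
    DHole A (Function.update x m v) := by
  obtain ⟨n1, n2, n3, n4, -⟩ := id hk
  intro i j
  by_cases hi : i = m <;> by_cases hj : j = m
  · subst hi; subst hj
    simp [hirr, n1]
  · subst hi
    simp only [Function.update_self, Function.update_of_ne hj]
    exact (hv j).1
  · subst hj
    simp only [Function.update_self, Function.update_of_ne hi]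
    rw [(hv i).2]
    constructor <;> intro h <;> rw [h] <;> ring
  · simp only [Function.update_of_ne hi, Function.update_of_ne hj]
    exact hx i j

theorem DHole.clone_arc_aux (hirr : ∀ x, ¬ A x x) (hD : ArcLocallyIn A) (hk : GoodR R)
    (hx : DHole A x) {v w : V} {m n : R}
    (hv : CloneAt A x m v) (hw : CloneAt A x n w) (hmn : n + 1 ≠ m) :
    (A v w ↔ n = m + 1) ∧ (A w v ↔ m = n + 1) := by
  classical
  obtain ⟨n1, n2, n3, n4, -⟩ := id hk
  have hx' := hx.swap hirr hk hv
  have h1 : A w (Function.update x m v (n+1)) := by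
    rw [Function.update_of_ne hmn]; exact (hw _).1.2 rfl
  have hself : Function.update x m v m = v := Function.update_self ..
  rcases hx'.trace hirr hD hk h1 with h | ⟨m', h⟩
  · exfalso
    obtain ⟨j, hj1, hj2⟩ : ∃ j : R, j ≠ m ∧ j ≠ n + 1 := by
      by_cases e : n + 2 = m
      · exact ⟨n, (fun h => n2 (by linear_combination e - h)), (fun h => n1 (by linear_combination -h))⟩
      · exact ⟨n + 2, e, (fun h => n1 (by linear_combination h))⟩
    have := (h j).1
    rw [Function.update_of_ne hj1] at this
    exact hj2 ((hw j).1.1 this)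
  · have e := (h _).1.1 h1
    have e' : m' = n := by linear_combination -e
    subst e'
    have := h m
    rw [hself] at this
    refine ⟨this.2.trans ?_, this.1⟩
    constructor <;> intro h <;> rw [h] <;> ring

theorem DHole.clone_arc (hirr : ∀ x, ¬ A x x) (hD : ArcLocallyIn A) (hk : GoodR R)
    (hx : DHole A x) {v w : V} {m n : R}
    (hv : CloneAt A x m v) (hw : CloneAt A x n w) :
    (A v w ↔ n = m + 1) := by
  obtain ⟨n1, n2, n3, n4, -⟩ := id hk
  by_cases hmn : n + 1 = m
  · exact (hx.clone_arc_aux hirr hD hk hw hv (fun h => n2 (by linear_combination h + hmn))).2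
  · exact (hx.clone_arc_aux hirr hD hk hv hw hmn).1

theorem CloneAt.uniq {v : V} {m n : R} (hv : CloneAt A x m v) (hw : CloneAt A x n v) :
    m = n := by
  have := (hw (m+1)).1.1 ((hv (m+1)).1.2 rfl)
  grind

end hole


/-! ### Bipartiteness from a level structure -/

def Ht (B : V → V → Prop) : ℕ → V → Prop
  | 0, z => ∀ y, ¬ B y z
  | n + 1, z => ∃ y, B y z ∧ Ht B n y

theorem Ht.exists {B : V → V → Prop} (r : V → ℕ) (hr : ∀ y z, B y z → r y < r z) :
    ∀ (n : ℕ) (z : V), r z ≤ n → ∃ m, Ht B m z := by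
  intro n
  induction n with
  | zero =>
    intro z hz
    refine ⟨0, fun y hy => ?_⟩
    have := hr y z hy
    omega
  | succ n ih =>
    intro z hz
    by_cases h : ∃ y, B y z
    · obtain ⟨y, hy⟩ := h
      have := hr y z hy
      obtain ⟨m, hm⟩ := ih y (by omega)
      exact ⟨m + 1, y, hy, hm⟩
    · push Not at h
      exact ⟨0, h⟩

theorem Ht.unique {B : V → V → Prop}
    (hs : ∀ w y1 z y2, B w y1 → B y1 z → B y2 z → B w y2) :
    ∀ (n m : ℕ) (z : V), Ht B n z → Ht B m z → n = m := by
  intro n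
  induction n with
  | zero =>
    rintro (_ | m) z h0 hm
    · rfl
    · obtain ⟨y, hy, -⟩ := hm
      exact absurd hy (h0 y)
  | succ n ih =>
    rintro (_ | m) z h0 hm
    · obtain ⟨y, hy, -⟩ := h0
      exact absurd hy (hm y)
    · obtain ⟨y1, hy1, h1⟩ := h0
      obtain ⟨y2, hy2, h2⟩ := hm
      have : Ht B n y2 := by
        cases n with
        | zero => exact fun w hw => h1 w (hs w y2 z y1 hw hy2 hy1)
        | succ n =>
          obtain ⟨w, hw, hwn⟩ := h1
          exact ⟨w, hs w y1 z y2 hw hy1 hy2, hwn⟩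
      rw [ih m y2 this h2]

theorem bip_of_rank {B : V → V → Prop} (r : V → ℕ) (hr : ∀ y z, B y z → r y < r z)
    (hs : ∀ w y1 z y2, B w y1 → B y1 z → B y2 z → B w y2) :
    ∃ T : Set V, ∀ u v, B u v → (u ∈ T ∧ v ∉ T) ∨ (u ∉ T ∧ v ∈ T) := by
  refine ⟨{z | ∃ n, Even n ∧ Ht B n z}, fun u v huv => ?_⟩
  obtain ⟨n, hn⟩ := Ht.exists r hr _ u le_rfl
  have hv : Ht B (n + 1) v := ⟨u, huv, hn⟩
  by_cases he : Even n
  · left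
    refine ⟨⟨n, he, hn⟩, ?_⟩
    rintro ⟨m, hm, hm'⟩
    have := Ht.unique hs _ _ _ hv hm'
    subst this
    exact absurd he (by rwa [Nat.even_add_one] at hm)
  · right
    refine ⟨?_, ⟨n + 1, by rwa [Nat.even_add_one], hv⟩⟩
    rintro ⟨m, hm, hm'⟩
    have := Ht.unique hs _ _ _ hn hm'
    subst this
    exact he hm

def Lv (B : V → V → Prop) (C : Set V) : ℕ → V → Prop
  | 0, z => z ∈ C
  | n + 1, z => ∃ y, B y z ∧ Lv B C n y

def Lev (B : V → V → Prop) (C : Set V) (n : ℕ) (z : V) : Prop :=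
  Lv B C n z ∧ ∀ m < n, ¬ Lv B C m z

theorem Lev.ex {B : V → V → Prop} {C : Set V} {n : ℕ} {z : V} (h : Lv B C n z) :
    ∃ m ≤ n, Lev B C m z := by
  classical
  have h' : ∃ n, Lv B C n z := ⟨n, h⟩
  exact ⟨Nat.find h', Nat.find_min' h' h, Nat.find_spec h', fun m hm => Nat.find_min h' hm⟩

theorem Lev.uniq {B : V → V → Prop} {C : Set V} {n m : ℕ} {z : V}
    (h : Lev B C n z) (h' : Lev B C m z) : n = m := by
  rcases lt_trichotomy n m with hl | hl | hl
  · exact absurd h.1 (h'.2 _ hl)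
  · exact hl
  · exact absurd h'.1 (h.2 _ hl)

theorem Lev.pred {B : V → V → Prop} {C : Set V}
    (hstar : ∀ w y1 z y2, B w y1 → B y1 z → B y2 z → w ≠ z → w ≠ y2 → y1 ≠ y2 →
      B w y2 ∨ B y2 w)
    (F3 : ∀ y z, z ∈ C → B y z → y ∈ C ∧ ∀ w, ¬ B w y)
    (F4 : ∀ y0 y z, y0 ∈ C → B y0 z → B y z → y ∈ C) :
    ∀ n z y, Lev B C n z → B y z → Lev B C (n - 1) y := by
  intro n
  induction n using Nat.strong_induction_on with
  | _ n ih =>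
  intro z y hz hy
  have zero : ∀ v, v ∈ C → Lev B C 0 v := fun v hv => ⟨hv, fun m hm => absurd hm (by omega)⟩
  rcases n with _ | n
  · exact zero _ (F3 y z hz.1 hy).1
  · obtain ⟨y0, hy0, hl⟩ := hz.1
    show Lev B C n y
    have low : ∀ v, B v z → ∀ m < n, ¬ Lv B C m v := fun v hv m hm h =>
      hz.2 (m + 1) (by omega) ⟨v, hv, h⟩
    refine ⟨?_, low y hy⟩
    rcases n with _ | n
    · exact F4 y0 y z hl hy0 hy
    · by_cases hyy : y0 = y
      · exact hyy ▸ hl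
      obtain ⟨w, hw, hwl⟩ := hl
      have hwL : Lev B C n w :=
        ⟨hwl, fun m hm h => low y0 hy0 (m + 1) (by omega) ⟨w, hw, h⟩⟩
      have hwz : w ≠ z := by
        rintro rfl
        exact hz.2 n (by omega) hwl
      have hwy : w ≠ y := by
        rintro rfl
        exact low w hy n (by omega) hwl
      rcases hstar w y0 z y hw hy0 hy hwz hwy hyy with h | h
      · exact ⟨w, h, hwl⟩
      · exact absurd (ih n (by omega) w y hwL h).1 (low y hy _ (by omega))

theorem bip_of_levels {B : V → V → Prop} {C : Set V}
    (hstar : ∀ w y1 z y2, B w y1 → B y1 z → B y2 z → w ≠ z → w ≠ y2 → y1 ≠ y2 →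
      B w y2 ∨ B y2 w)
    (F3 : ∀ y z, z ∈ C → B y z → y ∈ C ∧ ∀ w, ¬ B w y)
    (F4 : ∀ y0 y z, y0 ∈ C → B y0 z → B y z → y ∈ C)
    (F5 : ∀ y1 y2 z, y1 ∈ C → y2 ∈ C → B y2 y1 → B y1 z → B y2 z → False)
    (hreach : ∀ u v, B u v → ∃ n, Lv B C n u) :
    ∃ T : Set V, ∀ u v, B u v → (u ∈ T ∧ v ∉ T) ∨ (u ∉ T ∧ v ∈ T) := by
  classical
  have hpred := Lev.pred hstar F3 F4
  have hlev : ∀ v, ∃ n, (∃ m, Lv B C m v) → Lev B C n v := by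
    intro v
    by_cases h : ∃ m, Lv B C m v
    · obtain ⟨m, hm⟩ := h
      obtain ⟨n, -, hn⟩ := Lev.ex hm
      exact ⟨n, fun _ => hn⟩
    · exact ⟨0, fun h' => absurd h' h⟩
  choose lev hlev using hlev
  have l1 : ∀ u v, B u v → Lev B C (lev u) u := fun u v h => hlev u (hreach u v h)
  have l2 : ∀ u v, B u v → Lev B C (lev v) v := fun u v h => hlev v (by
    obtain ⟨n, hn⟩ := hreach u v h
    exact ⟨n + 1, u, h, hn⟩)
  have hp : ∀ u v, B u v → lev u = lev v - 1 := fun u v h =>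
    (l1 u v h).uniq (hpred _ _ _ (l2 u v h) h)
  have hC : ∀ u v, B u v → lev v = 0 → v ∈ C := fun u v h h0 => by
    have := (l2 u v h).1
    rw [h0] at this
    exact this
  have hC' : ∀ u v, B u v → lev u = 0 → u ∈ C := fun u v h h0 => by
    have := (l1 u v h).1
    rw [h0] at this
    exact this
  set r : V → ℕ := fun v => 2 * lev v + (if ∃ y, B y v then 1 else 0) with hrdef
  have rle : ∀ v, 2 * lev v ≤ r v ∧ r v ≤ 2 * lev v + 1 := by
    intro v
    simp only [hrdef]
    split_ifs <;> omega
  have hr : ∀ y z, B y z → r y < r z := by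
    intro y z h
    have e := hp y z h
    rcases Nat.eq_zero_or_pos (lev z) with h0 | h0
    · have hz := hC y z h h0
      have h1 : ¬ ∃ w, B w y := fun ⟨w, hw⟩ => (F3 y z hz h).2 w hw
      have h2 : ∃ w, B w z := ⟨y, h⟩
      simp only [hrdef, if_neg h1, if_pos h2]
      omega
    · have := rle y
      have := rle z
      omega
  apply bip_of_rank r hr
  intro w y1 z y2 h1 h2 h3
  by_cases hyy : y1 = y2
  · exact hyy ▸ h1
  have r1 := hr _ _ h1
  have r2 := hr _ _ h2
  have r3 := hr _ _ h3
  have hzpos : 0 < lev z := by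
    by_contra h0
    exact (F3 y1 z (hC _ _ h2 (by omega)) h2).2 w h1
  have e1 := hp _ _ h1
  have e2 := hp _ _ h2
  have e3 := hp _ _ h3
  have a1 := rle w
  have a2 := rle y1
  have a3 := rle z
  have a4 := rle y2
  by_cases hwy : w = y2
  · subst hwy
    exact (F5 y1 w z (hC' _ _ h2 (by omega)) (hC' _ _ h3 (by omega)) h1 h2 h3).elim
  rcases hstar w y1 z y2 h1 h2 h3 (by rintro rfl; omega) hwy hyy with h | h
  · exact h
  · have := hr _ _ h
    omega

/-! ### The structure around an induced odd directed cycle -/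

section around
variable {A : V → V → Prop} {R : Type*} [CommRing R] {x : R → V}

theorem DHole.dom_clone (hirr : ∀ x, ¬ A x x) (hD : ArcLocallyIn A) (hk : GoodR R)
    (hx : DHole A x) {u w : V} {m : R} (hu : DomAll A x u) (hw : CloneAt A x m w) :
    A u w ∧ ¬ A w u := by
  classical
  obtain ⟨n1, n2, n3, n4, -⟩ := id hk
  have hx' := hx.swap hirr hk hw
  have e1 : m + 1 ≠ m := fun h => n1 (by linear_combination h)
  have e2 : m + 2 ≠ m := fun h => n2 (by linear_combination h)
  have h1 : A u (Function.update x m w (m+1)) := by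
    rw [Function.update_of_ne e1]; exact (hu _).1
  have h2 : A u (Function.update x m w (m+2)) := by
    rw [Function.update_of_ne e2]; exact (hu _).1
  rcases hx'.trace hirr hD hk h1 with h | ⟨m', h⟩
  · have := h m
    rwa [Function.update_self] at this
  · have a := (h _).1.1 h1
    have b := (h _).1.1 h2
    exact absurd (by linear_combination b - a) n1

theorem DHole.no_arc (hirr : ∀ x, ¬ A x x) (hD : ArcLocallyIn A) (hk : GoodR R)
    (hx : DHole A x) {v w : V} {m : R} (hv : CloneAt A x m v)
    (hw1 : ¬ DomAll A x w) (hw2 : ∀ m, ¬ CloneAt A x m w) : ¬ A w v := by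
  classical
  intro hwv
  obtain ⟨n1, n2, n3, n4, -⟩ := id hk
  have hno : ∀ j, ¬ A w (x j) := fun j h => by
    rcases hx.trace hirr hD hk h with h | ⟨m, h⟩
    · exact hw1 h
    · exact hw2 _ h
  have hwx : ∀ j, w ≠ x j := fun j h => hw2 j (h ▸ hx.self_clone j)
  have hvx : v ≠ x m := fun h => hno m (h ▸ hwv)
  have hadj := ali hirr hD hwv ((hv _).1.2 rfl) (hx.arc m) (hwx _) (hwx _) hvx
  have hmw : A (x m) w := hadj.resolve_left (hno m)
  have hx' := hx.swap hirr hk hv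
  have e1 : m + 1 ≠ m := fun h => n1 (by linear_combination h)
  have e2 : m - 2 ≠ m := fun h => n2 (by linear_combination -h)
  have h1 : A w (Function.update x m v m) := by
    rw [Function.update_self]; exact hwv
  rcases hx'.trace hirr hD hk h1 with h | ⟨m', h⟩
  · have := (h (m+1)).1
    rw [Function.update_of_ne e1] at this
    exact hno _ this
  · have a := (h _).1.1 h1
    have := (h (m - 2)).2.2 (by linear_combination a)
    rw [Function.update_of_ne e2] at this
    have a1 : A (x (m-3)) (x (m-2)) := (hx _ _).2 (by ring)
    have := ali hirr hD a1 this hmw (hwx _).symm (hx.ne fun h => n3 (by linear_combination -h))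
      (hx.ne e2)
    rcases hx.adj this with h | h
    · exact n2 (by linear_combination h)
    · exact n4 (by linear_combination -h)

theorem DHole.bip (hirr : ∀ x, ¬ A x x) (hD : ArcLocallyIn A) (hk : GoodR R)
    (hx : DHole A x) (hconn : ConnOn A {v | DomAll A x v}ᶜ) :
    BipartiteOn A {v | ¬ DomAll A x v ∧ ∀ m, ¬ CloneAt A x m v} := by
  obtain ⟨n1, n2, n3, n4, -⟩ := id hk
  set V3 : Set V := {v | ¬ DomAll A x v ∧ ∀ m, ¬ CloneAt A x m v} with hV3
  have hno : ∀ {m v w}, CloneAt A x m v → w ∈ V3 → ¬ A w v := fun hv hw =>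
    hx.no_arc hirr hD hk hv hw.1 hw.2
  have hnn : ∀ {m v w}, CloneAt A x m v → w ∈ V3 → v ≠ w := fun hv hw h =>
    hw.2 _ (h ▸ hv)
  have hto : ∀ {m v w}, CloneAt A x m v → w ∈ V3 → DAdj A v w → A v w := fun hv hw h =>
    h.resolve_right (hno hv hw)
  have hself := hx.self_clone
  have F1a : ∀ {i j h h' w}, CloneAt A x i h → CloneAt A x j h' → w ∈ V3 → A h w → A h' w →
      i = j ∨ j = i - 1 ∨ j = i - 2 := by
    intro i j h h' w hh hh' hw a a'
    by_cases e : i = j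
    · exact Or.inl e
    right
    have hne : h ≠ h' := by
      rintro rfl
      exact e (hh.uniq hh')
    by_cases e2 : x (i-1) = h'
    · left
      exact (hh'.uniq (e2 ▸ hself _))
    · have := ali hirr hD ((hh _).2.2 rfl) a a' (hnn (hself _) hw) e2 hne
      rcases this with t | t
      · have := (hx.clone_arc hirr hD hk (hself _) hh').1 t
        exact absurd (by linear_combination -this) e
      · have := (hx.clone_arc hirr hD hk hh' (hself _)).1 t
        right
        linear_combination -this
  have F1 : ∀ {i j h h' w}, CloneAt A x i h → CloneAt A x j h' → w ∈ V3 → A h w → A h' w →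
      i = j := by
    intro i j h h' w hh hh' hw a a'
    rcases F1a hh hh' hw a a' with e | e | e
    · exact e
    · rcases F1a hh' hh hw a' a with f | f | f
      · exact f.symm
      · exact absurd (by linear_combination e + f) n2
      · exact absurd (by linear_combination e + f) n3
    · rcases F1a hh' hh hw a' a with f | f | f
      · exact f.symm
      · exact absurd (by linear_combination e + f) n3
      · exact absurd (by linear_combination e + f) n4
  have F2 : ∀ {i h u w}, CloneAt A x i h → w ∈ V3 → u ∈ V3 → A h w → A u w →
      A (x (i-1)) u := by
    intro i h u w hh hw hu a b
    exact hto (hself _) hu (ali hirr hD ((hh _).2.2 rfl) a b (hnn (hself _) hw)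
      (hnn (hself _) hu) (hnn hh hu))
  set B : V → V → Prop := fun y z => y ∈ V3 ∧ z ∈ V3 ∧ A y z with hB
  set C : Set V := {z | z ∈ V3 ∧ ∃ i h, CloneAt A x i h ∧ A h z} with hC
  have hstar : ∀ w y1 z y2, B w y1 → B y1 z → B y2 z → w ≠ z → w ≠ y2 → y1 ≠ y2 →
      B w y2 ∨ B y2 w := by
    rintro w y1 z y2 ⟨a1, a2, a3⟩ ⟨b1, b2, b3⟩ ⟨c1, c2, c3⟩ h1 h2 h3
    rcases ali hirr hD a3 b3 c3 h1 h2 h3 with h | h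
    · exact Or.inl ⟨a1, c1, h⟩
    · exact Or.inr ⟨c1, a1, h⟩
  have F3 : ∀ y z, z ∈ C → B y z → y ∈ C ∧ ∀ w, ¬ B w y := by
    rintro y z ⟨hz, i, h, hh, hhz⟩ ⟨hy, -, hyz⟩
    have hy1 := F2 hh hz hy hhz hyz
    refine ⟨⟨hy, _, _, hself _, hy1⟩, ?_⟩
    rintro w ⟨hw, -, hwy⟩
    have hw1 := F2 (hself _) hy hw hy1 hwy
    have key : A h w → False := fun t => by
      have := F1 hh (hself _) hw t hw1
      exact n2 (by linear_combination this)
    by_cases e : w = z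
    · exact key (e ▸ hhz)
    · exact key (hto hh hw (ali hirr hD hwy hyz hhz e (hnn hh hw).symm (hnn hh hy).symm).symm)
  have F4 : ∀ y0 y z, y0 ∈ C → B y0 z → B y z → y ∈ C := by
    rintro y0 y z ⟨hy0, i, h, hh, hhy⟩ ⟨-, hz, a⟩ ⟨hy, -, b⟩
    by_cases e : y0 = y
    · exact e ▸ ⟨hy0, i, h, hh, hhy⟩
    · exact ⟨hy, i, h, hh, hto hh hy (ali hirr hD hhy a b (hnn hh hz) (hnn hh hy) e)⟩
  have F5 : ∀ y1 y2 z, y1 ∈ C → y2 ∈ C → B y2 y1 → B y1 z → B y2 z → False := by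
    rintro y1 y2 z ⟨hy1, i, h, hh, hhy⟩ - ⟨hy2, -, a⟩ ⟨-, hz, b⟩ ⟨-, -, c⟩
    have t := F2 hh hy1 hy2 hhy a
    have hne : y2 ≠ y1 := fun e => hirr y1 (by rwa [e] at a)
    have := hto (hself _) hy1 (ali hirr hD t c b (hnn (hself _) hz) (hnn (hself _) hy1) hne)
    have := F1 hh (hself _) hy1 hhy this
    exact n1 (by linear_combination this)
  have hpred := Lev.pred hstar F3 F4
  have hreach : ∀ v, v ∈ V3 → ∃ n, Lv B C n v := by
    intro v hv
    have hp := hconn (x 0) (fun h => by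
      have := (h 1).2
      exact this ((hx _ _).2 (by
        by_contra
        have := (h 0).1
        exact hirr _ this))) v hv.1
    have : (∃ m, CloneAt A x m v) ∨ (v ∈ V3 ∧ ∃ n, Lv B C n v) := by
      clear hv
      induction hp with
      | refl => exact Or.inl ⟨0, hself 0⟩
      | @tail y z _ h ih =>
        obtain ⟨hy, hz, hyz⟩ := h
        by_cases hzc : ∃ m, CloneAt A x m z
        · exact Or.inl hzc
        right
        push Not at hzc
        have hz3 : z ∈ V3 := ⟨hz, hzc⟩
        refine ⟨hz3, ?_⟩
        rcases ih with ⟨m, hm⟩ | ⟨hy3, n, hn⟩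
        · exact ⟨0, hz3, m, y, hm, hto hm hz3 hyz⟩
        · rcases hyz with h | h
          · exact ⟨n + 1, y, ⟨hy3, hz3, h⟩, hn⟩
          · obtain ⟨m, -, hm⟩ := Lev.ex hn
            exact ⟨_, (hpred _ _ _ hm ⟨hz3, hy3, h⟩).1⟩
    rcases this with ⟨m, hm⟩ | h
    · exact absurd hm (hv.2 m)
    · exact h.2
  obtain ⟨T, hT⟩ := bip_of_levels hstar F3 F4 F5 (fun u v h => hreach u h.1)
  refine ⟨T, fun u hu v hv h => ?_⟩
  rcases h with h | h
  · exact hT u v ⟨hu, hv, h⟩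
  · rcases hT v u ⟨hv, hu, h⟩ with t | t
    · exact Or.inr ⟨t.2, t.1⟩
    · exact Or.inl ⟨t.2, t.1⟩

end around

theorem part_one {A : V → V → Prop} (hirr : ∀ x, ¬ A x x) (hD : ArcLocallyIn A)
    {k : ℕ} (hk5 : 5 ≤ k) (hodd : Odd k) {x : ZMod k → V} (hx : DHole A x)
    (hcut : ¬ HasCliqueCut A) :
    ∃ V1 V2 V3 : Set V, Disjoint V1 V2 ∧ Disjoint V1 V3 ∧ Disjoint V2 V3 ∧
        V1 ∪ V2 ∪ V3 = Set.univ ∧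
        SemicompleteOn A V1 ∧
        (∀ u ∈ V1, ∀ v ∈ V2, A u v) ∧
        (∀ v ∈ V2, ∀ u ∈ V1, ¬ A v u) ∧
        (∀ w ∈ V3, ∀ u ∈ V1, ¬ A w u) ∧
        IsOddExtCycle5On A V2 ∧
        (∀ w ∈ V3, ∀ v ∈ V2, ¬ A w v) ∧
        BipartiteOn A V3 := by
  have hk := goodR_zmod hk5 hodd
  obtain ⟨n1, n2, n3, n4, -⟩ := id hk
  have hself := hx.self_clone
  have hdx : ∀ {u j}, DomAll A x u → u ≠ x j := by
    intro u j h e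
    have := (h j).1
    rw [e] at this
    exact hirr _ this
  have hsemi : SemicompleteOn A {v | DomAll A x v} := by
    intro u hu v hv huv
    exact ali hirr hD (hu 0).1 (hx.arc 0) (hv _).1 (hdx hu) huv (hdx hv).symm
  have hconn : ConnOn A {v | DomAll A x v}ᶜ := by
    by_contra h
    exact hcut ⟨_, hsemi, h⟩
  refine ⟨{v | DomAll A x v}, ⋃ m, {v | CloneAt A x m v},
    {v | ¬ DomAll A x v ∧ ∀ m, ¬ CloneAt A x m v}, ?_, ?_, ?_, ?_, hsemi, ?_, ?_, ?_, ?_, ?_,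
    hx.bip hirr hD hk hconn⟩
  · rw [Set.disjoint_left]
    intro v hv hv2
    obtain ⟨m, hm⟩ := Set.mem_iUnion.1 hv2
    exact (hv _).2 ((hm _).2.2 rfl)
  · rw [Set.disjoint_left]
    exact fun v hv hv3 => hv3.1 hv
  · rw [Set.disjoint_left]
    intro v hv hv3
    obtain ⟨m, hm⟩ := Set.mem_iUnion.1 hv
    exact hv3.2 m hm
  · ext v
    simp only [Set.mem_union, Set.mem_ofPred_eq, Set.mem_iUnion, Set.mem_univ, iff_true]
    by_cases h1 : DomAll A x v
    · exact Or.inl (Or.inl h1)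
    by_cases h2 : ∃ m, CloneAt A x m v
    · exact Or.inl (Or.inr h2)
    · exact Or.inr ⟨h1, fun m hm => h2 ⟨m, hm⟩⟩
  · intro u hu v hv
    obtain ⟨m, hm⟩ := Set.mem_iUnion.1 hv
    exact (hx.dom_clone hirr hD hk hu hm).1
  · intro v hv u hu
    obtain ⟨m, hm⟩ := Set.mem_iUnion.1 hv
    exact (hx.dom_clone hirr hD hk hu hm).2
  · intro w hw u hu hwu
    have hwx : ∀ j, w ≠ x j := fun j h => hw.2 j (h ▸ hself j)
    have hall : ∀ j, A (x j) w := by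
      intro j
      have := ali hirr hD hwu (hu (j+1)).1 (hx.arc j) (hwx _) (hwx _) (hdx hu)
      exact this.resolve_left (hx.no_arc hirr hD hk (hself j) hw.1 hw.2)
    have a1 : A (x 0) (x 1) := (hx _ _).2 (by ring)
    have := ali hirr hD a1 (hall 1) (hall 3) (hwx _).symm
      (hx.ne fun h => n3 (by linear_combination -h)) (hx.ne fun h => n2 (by linear_combination -h))
    rcases hx.adj this with h | h
    · exact n2 (by linear_combination h)
    · exact n4 (by linear_combination -h)
  · refine ⟨k, hodd, hk5, by omega, fun m => {v | CloneAt A x m v}, fun m => ⟨x m, hself m⟩,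
      ?_, rfl, ?_⟩
    · intro i j hij
      rw [Set.disjoint_left]
      exact fun v h1 h2 => hij (CloneAt.uniq h1 h2)
    · intro u hu v hv
      obtain ⟨i, hi⟩ := Set.mem_iUnion.1 hu
      obtain ⟨j, hj⟩ := Set.mem_iUnion.1 hv
      have hi' : CloneAt A x i u := hi
      have hj' : CloneAt A x j v := hj
      rw [hx.clone_arc hirr hD hk hi' hj']
      constructor
      · intro h
        exact ⟨i, hi', by rw [← h]; exact hj'⟩
      · rintro ⟨l, hl1, hl2⟩
        have e1 := hi'.uniq hl1
        have e2 := hj'.uniq hl2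
        rw [e1, e2]
  · intro w hw v hv
    obtain ⟨m, hm⟩ := Set.mem_iUnion.1 hv
    exact hx.no_arc hirr hD hk hm hw.1 hw.2

/-! ### Walks and strong digraphs -/

def Wk (A : V → V → Prop) : ℕ → V → V → Prop
  | 0, u, v => u = v
  | n + 1, u, v => ∃ w, Wk A n u w ∧ A w v

theorem Wk.trans {A : V → V → Prop} {n m : ℕ} {u v w : V} (h1 : Wk A n u v) (h2 : Wk A m v w) :
    Wk A (n + m) u w := by
  induction m generalizing w with
  | zero => cases h2; exact h1
  | succ m ih =>
    obtain ⟨z, hz, hzw⟩ := h2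
    exact ⟨z, ih hz, hzw⟩

theorem Wk.one {A : V → V → Prop} {u v : V} (h : A u v) : Wk A 1 u v := ⟨u, rfl, h⟩

/-- There is a pair of vertices, the neighbourhood of one of which dominates the other's. -/
def DomPair (A : V → V → Prop) : Prop :=
  ∃ u v, u ≠ v ∧ ∀ x, x ≠ v → DAdj A x u → DAdj A x v

def NoHole (A : V → V → Prop) : Prop :=
  ∀ k : ℕ, 5 ≤ k → Odd k → ∀ x : ZMod k → V, ¬ DHole A x

section strong
variable {A : V → V → Prop}

theorem Wk.exists_fun {n : ℕ} {u v : V} (h : Wk A n u v) :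
    ∃ f : ℕ → V, f 0 = u ∧ f n = v ∧ ∀ i < n, A (f i) (f (i+1)) := by
  induction n generalizing v with
  | zero => exact ⟨fun _ => u, rfl, h, fun i hi => absurd hi (by omega)⟩
  | succ n ih =>
    obtain ⟨w, hw, hwv⟩ := h
    obtain ⟨f, h0, hn, hf⟩ := ih hw
    refine ⟨fun i => if i ≤ n then f i else v, by simp [h0], by simp, ?_⟩
    intro i hi
    rcases Nat.lt_or_ge i n with h | h
    · have h1 : i ≤ n := by omega
      have h2 : i + 1 ≤ n := by omega
      simp only [h1, h2, if_true]
      exact hf i h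
    · have : i = n := by omega
      subst this
      simp [hn, hwv]

theorem Wk.exists_cyc {k : ℕ} (hk : 0 < k) {u : V} (h : Wk A k u u) :
    ∃ x : ZMod k → V, ∀ i, A (x i) (x (i+1)) := by
  obtain ⟨f, h0, hn, hf⟩ := h.exists_fun
  have : NeZero k := ⟨by omega⟩
  refine ⟨fun i => f i.val, fun i => ?_⟩
  have hi := ZMod.val_lt i
  by_cases h1 : i.val + 1 < k
  · have : (i + 1).val = i.val + 1 := by
      have e : i + 1 = ((i.val + 1 : ℕ) : ZMod k) := by
        push_cast
        rw [ZMod.natCast_zmod_val]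
      rw [e, ZMod.val_natCast, Nat.mod_eq_of_lt h1]
    show A (f i.val) (f (i+1).val)
    rw [this]
    exact hf _ hi
  · have e : i.val + 1 = k := by omega
    have : (i + 1) = 0 := by
      have : ((i.val + 1 : ℕ) : ZMod k) = 0 := by rw [e]; exact ZMod.natCast_self k
      push_cast at this
      rwa [ZMod.natCast_zmod_val] at this
    show A (f i.val) (f (i+1).val)
    rw [this, ZMod.val_zero, h0, ← hn]
    have := hf _ hi
    rwa [e] at this

theorem cyc_walk {k : ℕ} {x : ZMod k → V} (hx : ∀ i, A (x i) (x (i+1))) (i : ZMod k) (n : ℕ) :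
    Wk A n (x i) (x (i + n)) := by
  induction n with
  | zero => simp [Wk]
  | succ n ih =>
    refine ⟨_, ih, ?_⟩
    have := hx (i + n)
    convert this using 2
    push_cast; ring

theorem shortest_hole (hirr : ∀ x, ¬ A x x) (hD : ArcLocallyIn A) {k : ℕ} (hk5 : 5 ≤ k)
    (hodd : Odd k) {x : ZMod k → V} (hx : ∀ i, A (x i) (x (i+1)))
    (hmin : ∀ m u, Odd m → Wk A m u u → k ≤ m) : DHole A x := by
  have : NeZero k := ⟨by omega⟩
  have hk0 : (k : ZMod k) = 0 := ZMod.natCast_self k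
  have hback : ∀ i (d : ℕ), d ≤ k → Wk A (k - d) (x (i + d)) (x i) := by
    intro i d hd
    have := cyc_walk hx (i + d) (k - d)
    convert this using 2
    rw [add_assoc, ← Nat.cast_add, Nat.add_sub_cancel' hd, hk0, add_zero]
  have hE : ∀ i (d : ℕ), 0 < d → d < k → x i ≠ x (i + d) := by
    intro i d h0 hd h
    have w1 := cyc_walk hx i d
    have w2 := hback i d hd.le
    rw [← h] at w1 w2
    rcases Nat.even_or_odd d with hde | hdo
    · have : Odd (k - d) := by
        rw [Nat.odd_sub hd.le]
        exact ⟨fun _ => hde, fun _ => hodd⟩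
      have := hmin _ _ this w2
      omega
    · have := hmin _ _ hdo w1
      omega
  have hO : ∀ i (d : ℕ), 2 ≤ d → d < k → Odd d → ¬ A (x i) (x (i + d)) := by
    intro i d h2 hd hdo h
    have w := (Wk.one h).trans (hback i d hd.le)
    have : Odd (1 + (k - d)) := by
      obtain ⟨a, ha⟩ := hodd
      obtain ⟨b, hb⟩ := hdo
      exact ⟨a - b, by omega⟩
    have := hmin _ _ this w
    omega
  have h2 : ∀ i, ¬ A (x i) (x (i + 2)) := by
    have shift : ∀ i, A (x i) (x (i + 2)) → A (x (i - 1)) (x (i - 1 + 2)) := by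
      intro i h
      have e0 := hx (i - 1)
      have e1 := hx (i + 1)
      have q1 : i - 1 + 1 = i := by ring
      have q2 : i + 1 + 1 = i + 2 := by ring
      have q3 : i - 1 + 2 = i + 1 := by ring
      rw [q1] at e0
      rw [q2] at e1
      rw [q3]
      have d1 : x (i - 1) ≠ x (i + 2) := by
        have := hE (i - 1) 3 (by omega) (by omega)
        convert this using 2
        push_cast; ring
      have d2 : x (i - 1) ≠ x (i + 1) := by
        have := hE (i - 1) 2 (by omega) (by omega)
        convert this using 2
        push_cast; ring
      have d3 : x i ≠ x (i + 1) := fun e => hirr (x i) (by have := hx i; rwa [← e] at this)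
      rcases ali hirr hD e0 h e1 d1 d2 d3 with t | t
      · exact t
      · exfalso
        refine hO (i + 1) (k - 2) (by omega) (by omega) ?_ ?_
        · obtain ⟨a, ha⟩ := hodd
          exact ⟨a - 1, by omega⟩
        · convert t using 2
          rw [Nat.cast_sub (by omega), hk0]
          push_cast; ring
    intro i h
    have s1 := shift _ (shift _ h)
    have q : i - 1 - 1 + 2 = i := by ring
    rw [q] at s1
    have w := cyc_walk hx (i + 2) (k - 4)
    have q' : i + 2 + ((k - 4 : ℕ) : ZMod k) = i - 1 - 1 := by
      rw [Nat.cast_sub (by omega), hk0]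
      push_cast; ring
    rw [q'] at w
    have w' := ((Wk.one s1).trans (Wk.one h)).trans w
    have : Odd (1 + 1 + (k - 4)) := by
      obtain ⟨a, ha⟩ := hodd
      exact ⟨a - 1, by omega⟩
    have := hmin _ _ this w'
    omega
  have hev : ∀ n : ℕ, ∀ i, 2 * n + 5 ≤ k → ¬ A (x i) (x (i + (2 * n + 2 : ℕ))) := by
    intro n
    induction n with
    | zero =>
      intro i _ h
      exact h2 i (by simpa using h)
    | succ n ih =>
      intro i hn h
      have e0 := hx (i + (2 * n + 2 : ℕ))
      have e1 := hx (i + (2 * n + 3 : ℕ))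
      have q1 : i + ((2 * n + 2 : ℕ) : ZMod k) + 1 = i + (2 * n + 3 : ℕ) := by push_cast; ring
      have q2 : i + ((2 * n + 3 : ℕ) : ZMod k) + 1 = i + (2 * (n + 1) + 2 : ℕ) := by
        push_cast; ring
      rw [q1] at e0
      rw [q2] at e1
      have d1 : x (i + (2 * n + 2 : ℕ)) ≠ x (i + (2 * (n + 1) + 2 : ℕ)) := by
        have := hE (i + (2 * n + 2 : ℕ)) 2 (by omega) (by omega)
        convert this using 2
        push_cast; ring
      have d2 : x (i + (2 * n + 2 : ℕ)) ≠ x i := (hE i _ (by omega) (by omega)).symm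
      have d3 : x (i + (2 * n + 3 : ℕ)) ≠ x i := (hE i _ (by omega) (by omega)).symm
      rcases ali hirr hD e0 e1 h d1 d2 d3 with t | t
      · refine hO (i + (2 * n + 2 : ℕ)) (k - (2 * n + 2)) (by omega) (by omega) ?_ ?_
        · obtain ⟨a, ha⟩ := hodd
          exact ⟨a - n - 1, by omega⟩
        · convert t using 2
          rw [Nat.cast_sub (by omega), hk0]
          push_cast; ring
      · exact ih i (by omega) t
  have hlast : ∀ i, ¬ A (x i) (x (i - 1)) := by
    intro i h
    have e0 := hx (i - 3)
    have e1 := hx (i - 2)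
    have q1 : i - 3 + 1 = i - 2 := by ring
    have q2 : i - 2 + 1 = i - 1 := by ring
    rw [q1] at e0
    rw [q2] at e1
    have d1 : x (i - 3) ≠ x (i - 1) := by
      have := hE (i - 3) 2 (by omega) (by omega)
      convert this using 2
      push_cast; ring
    have d2 : x (i - 3) ≠ x i := by
      have := hE (i - 3) 3 (by omega) (by omega)
      convert this using 2
      push_cast; ring
    have d3 : x (i - 2) ≠ x i := by
      have := hE (i - 2) 2 (by omega) (by omega)
      convert this using 2
      push_cast; ring
    rcases ali hirr hD e0 e1 h d1 d2 d3 with t | t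
    · refine hO (i - 3) 3 (by omega) (by omega) (by decide) ?_
      convert t using 2
      push_cast; ring
    · obtain ⟨a, ha⟩ := hodd
      refine hev (a - 2) i (by omega) ?_
      convert t using 2
      have : 2 * (a - 2) + 2 = k - 3 := by omega
      rw [this, Nat.cast_sub (by omega), hk0]
      push_cast; ring
  intro i j
  constructor
  · intro h
    set d := (j - i).val with hd
    have hdk : d < k := ZMod.val_lt _
    have ej : j = i + (d : ZMod k) := by rw [hd, ZMod.natCast_zmod_val]; ring
    rw [ej] at h ⊢
    rcases Nat.even_or_odd d with hde | hdo
    · exfalso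
      obtain ⟨b, hb⟩ := hde
      rcases Nat.eq_zero_or_pos b with h0 | h0
      · have : d = 0 := by omega
        rw [this] at h
        exact hirr _ (by simpa using h)
      · by_cases hl : d + 1 = k
        · apply hlast i
          convert h using 2
          have : (d : ZMod k) + 1 = 0 := by
            have : ((d + 1 : ℕ) : ZMod k) = 0 := by rw [hl]; exact hk0
            simpa using this
          linear_combination -this
        · obtain ⟨a, ha⟩ := hodd
          refine hev (b - 1) i (by omega) ?_
          have : 2 * (b - 1) + 2 = d := by omega
          rw [this]
          exact h
    · by_cases h1 : d = 1
      · rw [h1]; simp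
      · obtain ⟨b, hb⟩ := id hdo
        exact absurd h (hO i d (by omega) hdk hdo)
  · rintro rfl
    exact hx i

def NA (A : V → V → Prop) (v a : V) : Prop := v = a ∨ DAdj A v a

def Adj2 (A : V → V → Prop) (a b c v : V) : Prop :=
  (NA A v a ∧ NA A v b) ∨ (NA A v b ∧ NA A v c) ∨ (NA A v c ∧ NA A v a)

theorem claimA (hirr : ∀ x, ¬ A x x) (hD : ArcLocallyIn A) {a b c : V}
    (hab : A a b) (hbc : A b c) (hca : A c a) {n : ℕ} {v : V} (h : Wk A n v a) :
    Adj2 A a b c v := by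
  have nab : a ≠ b := fun e => hirr a (by rwa [← e] at hab)
  have nbc : b ≠ c := fun e => hirr b (by rwa [← e] at hbc)
  have nca : c ≠ a := fun e => hirr c (by rwa [← e] at hca)
  have main : ∀ n v w, Wk A n v w → Adj2 A a b c w → Adj2 A a b c v := by
    intro n
    induction n with
    | zero => rintro v w rfl h; exact h
    | succ n ih =>
      rintro v w ⟨v1, hv1, hw⟩ h
      apply ih v v1 hv1
      by_cases ea : v1 = a
      · subst ea; exact Or.inl ⟨Or.inl rfl, Or.inr (Or.inl hab)⟩
      by_cases eb : v1 = b
      · subst eb; exact Or.inr (Or.inl ⟨Or.inl rfl, Or.inr (Or.inl hbc)⟩)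
      by_cases ec : v1 = c
      · subst ec; exact Or.inr (Or.inr ⟨Or.inl rfl, Or.inr (Or.inl hca)⟩)
      have rot : ∀ p q r : V, A p q → A q r → A r p → q ≠ r → r ≠ p →
          v1 ≠ p → v1 ≠ q → v1 ≠ r → NA A w p → (w = p → NA A v1 q) ∧ 
            (w ≠ p → w ≠ q → w ≠ r → NA A v1 r) := by
        intro p q r hpq hqr hrp nqr nrp e1 e2 e3 hwp
        constructor
        · rintro rfl
          exact Or.inr (ali hirr hD hqr hrp hw (by
            rintro rfl
            exact hirr _ hpq) e2.symm e3.symm).symm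
        · intro f1 f2 f3
          rcases hwp with e | hwp | hpw
          · exact absurd e f1
          · exact Or.inr (ali hirr hD hw hwp hrp e1 e3 f3)
          · exact Or.inr (ali hirr hD hrp hpw hw (Ne.symm f3) (Ne.symm e3) (Ne.symm e1)).symm
      have ra := rot a b c hab hbc hca nbc nca ea eb ec
      have rb := rot b c a hbc hca hab nca nab eb ec ea
      have rc := rot c a b hca hab hbc nab nbc ec ea eb
      by_cases fa : w = a
      · have := (ra (Or.inl fa)).1 fa
        subst fa
        exact Or.inl ⟨Or.inr (Or.inl hw), this⟩
      by_cases fb : w = b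
      · have := (rb (Or.inl fb)).1 fb
        subst fb
        exact Or.inr (Or.inl ⟨Or.inr (Or.inl hw), this⟩)
      by_cases fc : w = c
      · have := (rc (Or.inl fc)).1 fc
        subst fc
        exact Or.inr (Or.inr ⟨Or.inr (Or.inl hw), this⟩)
      rcases h with ⟨h1, h2⟩ | ⟨h1, h2⟩ | ⟨h1, h2⟩
      · exact Or.inr (Or.inr ⟨(ra h1).2 fa fb fc, (rb h2).2 fb fc fa⟩)
      · exact Or.inl ⟨(rb h1).2 fb fc fa, (rc h2).2 fc fa fb⟩
      · exact Or.inr (Or.inl ⟨(rc h1).2 fc fa fb, (ra h2).2 fa fb fc⟩)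
  exact main n v a h (Or.inl ⟨Or.inl rfl, Or.inr (Or.inl hab)⟩)

def BadS (A : V → V → Prop) (a b c w : V) : Prop :=
  w ≠ a ∧ w ≠ b ∧ w ≠ c ∧ A a w ∧ A b w ∧ ¬ A w a ∧ ¬ A w b ∧ ¬ DAdj A w c

/-- A vertex not adjacent to `c` is dominated by `b`. -/
theorem claimB_half (hirr : ∀ x, ¬ A x x) (hD : ArcLocallyIn A) {a b c : V}
    (hab : A a b) (hbc : A b c) (hca : A c a) {w : V} (hA : Adj2 A a b c w)
    (hwc : w ≠ c) (hnc : ¬ DAdj A w c) :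
    w ≠ a ∧ w ≠ b ∧ DAdj A w a ∧ A b w ∧ ¬ A w b := by
  have e1 : w ≠ a := by rintro rfl; exact hnc (Or.inr hca)
  have e2 : w ≠ b := by rintro rfl; exact hnc (Or.inl hbc)
  have hc : ¬ NA A w c := by
    rintro (h | h)
    · exact hwc h
    · exact hnc h
  have h12 : NA A w a ∧ NA A w b := by
    rcases hA with h | h | h
    · exact h
    · exact absurd h.2 hc
    · exact absurd h.1 hc
  have h1 := h12.1.resolve_left e1
  have h2 := h12.2.resolve_left e2
  have h3 : ¬ A w b := by
    intro h
    exact hnc (ali hirr hD hca hab h (by rintro rfl; exact hirr _ hbc) (Ne.symm hwc) (Ne.symm e1)).symm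
  exact ⟨e1, e2, h1, h2.resolve_left h3, h3⟩

theorem BadS.step (hirr : ∀ x, ¬ A x x) (hD : ArcLocallyIn A) {a b c : V}
    (hab : A a b) (hbc : A b c) (hca : A c a) (hA : ∀ w, Adj2 A a b c w) {w w1 : V}
    (hw : BadS A a b c w) (h : A w w1) : BadS A b c a w1 := by
  obtain ⟨wa, wb, wc, aw, bw, nwa, nwb, nwc⟩ := hw
  have e1 : w1 ≠ a := by rintro rfl; exact nwa h
  have e2 : w1 ≠ b := by rintro rfl; exact nwb h
  have e3 : w1 ≠ c := by rintro rfl; exact nwc (Or.inl h)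
  have hna : ¬ DAdj A w1 a := by
    rintro (t | t)
    · exact nwc (ali hirr hD h t hca wa wc e3)
    · exact nwc (ali hirr hD hca t h (Ne.symm e3) (Ne.symm wc) (Ne.symm wa)).symm
  have hA' : Adj2 A b c a w1 := by
    rcases hA w1 with t | t | t
    · exact Or.inr (Or.inr t)
    · exact Or.inl t
    · exact Or.inr (Or.inl t)
  obtain ⟨-, -, hb, hc, hnc⟩ := claimB_half hirr hD hbc hca hab hA' e1 hna
  have hnb : ¬ A w1 b := by
    intro t
    have nab : a ≠ b := fun e => hirr a (by rwa [← e] at hab)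
    exact hna (ali hirr hD t bw aw (fun e => hirr w (by rwa [e] at h)) e1 nab.symm)
  exact ⟨e2, e3, e1, hb.resolve_left hnb, hc, hnb, hnc, hna⟩

theorem claimB (hirr : ∀ x, ¬ A x x) (hD : ArcLocallyIn A) (hst : ∀ u v, ∃ n, Wk A n u v)
    {a b c : V} (hab : A a b) (hbc : A b c) (hca : A c a) {w : V}
    (hwc : w ≠ c) (hnc : ¬ DAdj A w c) : A b w ∧ A w a := by
  have hA : ∀ w, Adj2 A a b c w := fun w => claimA hirr hD hab hbc hca (hst w a).choose_spec
  have hA1 : ∀ w, Adj2 A b c a w := fun w => claimA hirr hD hbc hca hab (hst w b).choose_spec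
  have hA2 : ∀ w, Adj2 A c a b w := fun w => claimA hirr hD hca hab hbc (hst w c).choose_spec
  obtain ⟨e1, e2, h1, h2, h3⟩ := claimB_half hirr hD hab hbc hca (hA w) hwc hnc
  refine ⟨h2, ?_⟩
  by_contra hwa
  have hS : BadS A a b c w := ⟨e1, e2, hwc, h1.resolve_left hwa, h2, hwa, h3, hnc⟩
  have inv : ∀ n z, Wk A n w z → BadS A a b c z ∨ BadS A b c a z ∨ BadS A c a b z := by
    intro n
    induction n with
    | zero => rintro z rfl; exact Or.inl hS
    | succ n ih =>
      rintro z ⟨y, hy, hyz⟩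
      rcases ih y hy with t | t | t
      · exact Or.inr (Or.inl (t.step hirr hD hab hbc hca hA hyz))
      · exact Or.inr (Or.inr (t.step hirr hD hbc hca hab hA1 hyz))
      · exact Or.inl (t.step hirr hD hca hab hbc hA2 hyz)
  obtain ⟨n, hn⟩ := hst w a
  rcases inv n a hn with t | t | t
  · exact t.1 rfl
  · exact t.2.2.1 rfl
  · exact t.2.1 rfl

theorem strong_domPair (hirr : ∀ x, ¬ A x x) (hD : ArcLocallyIn A) (hno : NoHole A)
    (hst : ∀ u v, ∃ n, Wk A n u v) (hodd : ∃ n u, Odd n ∧ Wk A n u u) : DomPair A := by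
  classical
  have hex : ∃ n, Odd n ∧ ∃ u, Wk A n u u := by
    obtain ⟨n, u, h1, h2⟩ := hodd
    exact ⟨n, h1, u, h2⟩
  set k := Nat.find hex with hkdef
  obtain ⟨hko, u, hu⟩ := Nat.find_spec hex
  rw [← hkdef] at hko hu
  have hmin : ∀ m u, Odd m → Wk A m u u → k ≤ m := fun m u h1 h2 =>
    Nat.find_min' hex ⟨h1, u, h2⟩
  have hkpos : 0 < k := hko.pos
  have hk1 : k ≠ 1 := by
    intro h
    rw [h] at hu
    obtain ⟨w, rfl, h⟩ := hu
    exact hirr _ h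
  have hk3 : k = 3 := by
    by_contra h3
    have h5 : 5 ≤ k := by
      obtain ⟨a, ha⟩ := hko
      omega
    obtain ⟨x, hx⟩ := hu.exists_cyc hkpos
    exact hno k h5 hko x (shortest_hole hirr hD h5 hko hx hmin)
  rw [hk3] at hu
  obtain ⟨b, ⟨a, ⟨c, rfl, hca⟩, hab⟩, hbc⟩ := hu
  by_cases hall : ∃ w, w ≠ u ∧ ¬ DAdj A w u
  · obtain ⟨w, hwc, hnc⟩ := hall
    refine ⟨w, u, hwc, fun x hxc hxw => ?_⟩
    by_contra hx
    obtain ⟨b1, a1⟩ := claimB hirr hD hst hab hbc hca hwc hnc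
    obtain ⟨b2, a2⟩ := claimB hirr hD hst hab hbc hca hxc hx
    have wa : w ≠ a := by rintro rfl; exact hnc (Or.inr hca)
    have xa : x ≠ a := by rintro rfl; exact hx (Or.inr hca)
    rcases hxw with t | t
    · exact hx (ali hirr hD t a1 hca xa hxc hwc)
    · exact hnc (ali hirr hD t a2 hca wa hwc hxc)
  · push Not at hall
    exact ⟨a, u, fun e => hirr u (by rwa [e] at hca), fun x hx _ => hall x hx⟩

end strong

/-! ### Digraphs without induced odd directed cycles -/

def Rch (A : V → V → Prop) (u v : V) : Prop := ∃ n, Wk A n u v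

def Recu (A : V → V → Prop) (v : V) : Prop := ∀ w, Rch A v w → Rch A w v

section key
variable {A : V → V → Prop}

theorem Rch.refl (v : V) : Rch A v v := ⟨0, rfl⟩

theorem Rch.trans {u v w : V} (h1 : Rch A u v) (h2 : Rch A v w) : Rch A u w := by
  obtain ⟨n, hn⟩ := h1
  obtain ⟨m, hm⟩ := h2
  exact ⟨n + m, hn.trans hm⟩

theorem Rch.one {u v : V} (h : A u v) : Rch A u v := ⟨1, Wk.one h⟩

theorem Recu.of_rch {u v : V} (h : Recu A u) (huv : Rch A u v) : Recu A v := fun w hw =>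
  (h w (huv.trans hw)).trans huv

theorem exists_recu [Finite V] (v : V) : ∃ r, Rch A v r ∧ Recu A r := by
  have main : ∀ n : ℕ, ∀ v : V, {w | Rch A v w}.ncard ≤ n → ∃ r, Rch A v r ∧ Recu A r := by
    intro n
    induction n with
    | zero =>
      intro v hv
      have h0 : {w | Rch A v w} = ∅ := by
        rwa [Nat.le_zero, Set.ncard_eq_zero (Set.toFinite _)] at hv
      have : v ∈ ({w | Rch A v w} : Set V) := Rch.refl v
      rw [h0] at this
      exact this.elim
    | succ n ih =>
      intro v hv
      by_cases h : Recu A v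
      · exact ⟨v, Rch.refl v, h⟩
      · unfold Recu at h
        push Not at h
        obtain ⟨w, h1, h2⟩ := h
        have hlt : {z | Rch A w z}.ncard < {z | Rch A v z}.ncard := by
          apply Set.ncard_lt_ncard _ (Set.toFinite _)
          refine ⟨fun z hz => h1.trans hz, fun hs => h2 ?_⟩
          have : v ∈ ({z | Rch A v z} : Set V) := Rch.refl v
          exact hs this
        obtain ⟨r, hr1, hr2⟩ := ih w (by omega)
        exact ⟨r, h1.trans hr1, hr2⟩
  exact main _ v le_rfl

/-- Induced subdigraph. -/
def Ind (A : V → V → Prop) (S : Set V) : S → S → Prop := fun a b => A a b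

theorem Ind.irr (hirr : ∀ x, ¬ A x x) (S : Set V) : ∀ x, ¬ Ind A S x x := fun x => hirr x

theorem Ind.ali (hD : ArcLocallyIn A) (S : Set V) : ArcLocallyIn (Ind A S) := by
  intro a b c d h1 h2 h3 h4 h5 h6 h7 h8 h9
  have cv : ∀ {p q : S}, p ≠ q → (p : V) ≠ q := fun h e => h (Subtype.ext e)
  exact hD a b c d (cv h1) (cv h2) (cv h3) (cv h4) (cv h5) (cv h6) h7 h8 h9

theorem Ind.noHole (h : NoHole A) (S : Set V) : NoHole (Ind A S) :=
  fun k hk ho x hx => h k hk ho (fun i => (x i : V)) hx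

theorem Ind.walk {S : Set V} (hS : ∀ u v, u ∈ S → A u v → v ∈ S) {n : ℕ} {u v : V} (hu : u ∈ S)
    (h : Wk A n u v) : ∃ hv : v ∈ S, Wk (Ind A S) n ⟨u, hu⟩ ⟨v, hv⟩ := by
  induction n generalizing v with
  | zero =>
    have e : u = v := h
    subst e
    exact ⟨hu, rfl⟩
  | succ n ih =>
    obtain ⟨w, hw, hwv⟩ := h
    obtain ⟨hw', hh⟩ := ih hw
    exact ⟨hS w v hw' hwv, ⟨w, hw'⟩, hh, hwv⟩

theorem sink_pred (hirr : ∀ x, ¬ A x x) (hD : ArcLocallyIn A) (hnd : ¬ DomPair A) {y x p : V}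
    (hy : ∀ z, ¬ A y z) (hxy : A x y) (hpx : A p x) : False := by
  apply hnd
  have hpy : y ≠ p := by rintro rfl; exact hy _ hpx
  refine ⟨y, p, hpy, fun z hzp hz => ?_⟩
  have hzy : A z y := hz.resolve_right (hy z)
  by_cases e : x = z
  · exact Or.inr (e ▸ hpx)
  · exact (ali hirr hD hpx hxy hzy hpy.symm (Ne.symm hzp) e).symm

theorem recu_pred (hirr : ∀ x, ¬ A x x) (hD : ArcLocallyIn A) (hnd : ¬ DomPair A) {x y v : V}
    (hx : Recu A x) (hxy : A x y) (hvx : A v x) : Rch A x v := by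
  by_contra hxv
  apply hnd
  have hne : ∀ z, Rch A x z → z ≠ v := fun z hz e => hxv (e ▸ hz)
  have hQ : ∀ m : ℕ, ∀ z x', Rch A x z → Wk A (m + m) z x' → A v x' → A v z := by
    intro m
    induction m with
    | zero =>
      intro z x' _ hw h
      have e : z = x' := by simpa [Wk] using hw
      exact e ▸ h
    | succ m ih =>
      intro z x' hz hw h
      have e : m + 1 + (m + 1) = m + m + 1 + 1 := by omega
      rw [e] at hw
      obtain ⟨w1, ⟨w2, h2, h21⟩, h1⟩ := hw
      have r2 : Rch A x w2 := hz.trans ⟨_, h2⟩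
      have r1 : Rch A x w1 := r2.trans (Rch.one h21)
      apply ih z w2 hz h2
      by_cases e : w2 = x'
      · exact e ▸ h
      · exact (ali hirr hD h21 h1 h e (hne _ r2) (hne _ r1)).resolve_left
          (fun t => hxv (r2.trans (Rch.one t)))
  have ry : Rch A x y := Rch.one hxy
  refine ⟨y, v, hne y ry, fun z hzv hzy => ?_⟩
  by_cases hz : Rch A x z
  · right
    obtain ⟨a, ha⟩ := hx y ry
    have fin : ∀ m, Even m → Wk A m z x → A v z := by
      rintro m ⟨l, rfl⟩ h
      exact hQ l z x hz h hvx
    have cx : Wk A (1 + a) x x := (Wk.one hxy).trans ha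
    rcases hzy with h | h
    · have w1 : Wk A (1 + a) z x := (Wk.one h).trans ha
      rcases Nat.even_or_odd (1 + a) with he | ho
      · exact fin _ he w1
      · exact fin _ (ho.add_odd ho) (w1.trans cx)
    · obtain ⟨b, hb⟩ := (hx.of_rch ry) z (Rch.one h)
      have w1 : Wk A (b + a) z x := hb.trans ha
      rcases Nat.even_or_odd (b + a) with he | ho
      · exact fin _ he w1
      · rcases Nat.even_or_odd a with hea | hoa
        · refine fin _ ?_ (w1.trans cx)
          exact ho.add_odd (by rw [Nat.add_comm]; exact hea.add_one)
        · refine fin _ ?_ ((hb.trans (Wk.one h)).trans w1)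
          have hb' : Even b := by
            by_contra hb'
            rw [Nat.not_even_iff_odd] at hb'
            exact (Nat.not_even_iff_odd.2 ho) (hb'.add_odd hoa)
          exact hb'.add_one.add_odd ho
  · have hzy' : A z y := hzy.resolve_right (fun t => hz (ry.trans (Rch.one t)))
    exact (ali hirr hD hvx hxy hzy' (hne y ry).symm (Ne.symm hzv)
      (fun e => hz (e ▸ Rch.refl x))).symm

/-- Recurrent vertices that are not sinks. -/
def RN (A : V → V → Prop) (v : V) : Prop := Recu A v ∧ ∃ w, A v w

theorem RN.pred (hirr : ∀ x, ¬ A x x) (hD : ArcLocallyIn A) (hnd : ¬ DomPair A) {x v : V}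
    (hx : RN A x) (h : A v x) : Rch A x v ∧ RN A v := by
  obtain ⟨h1, y, hy⟩ := hx
  have := recu_pred hirr hD hnd h1 hy h
  exact ⟨this, h1.of_rch this, x, h⟩

theorem RN.succ {x v : V} (hx : RN A x) (h : A x v) : RN A v := by
  refine ⟨hx.1.of_rch (Rch.one h), ?_⟩
  by_contra hs
  push Not at hs
  obtain ⟨n, hn⟩ := hx.1 v (Rch.one h)
  obtain ⟨f, h0, hfn, hf⟩ := hn.exists_fun
  rcases Nat.eq_zero_or_pos n with e | e
  · subst e
    have e : v = x := hn
    exact hs v (by rw [← e] at h; exact h)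
  · exact hs _ (h0 ▸ hf 0 e)

theorem RN.rch {x v : V} (hx : RN A x) (h : Rch A x v) : RN A v := by
  obtain ⟨n, hn⟩ := h
  induction n generalizing v with
  | zero =>
    have e : x = v := hn
    exact e ▸ hx
  | succ n ih =>
    obtain ⟨w, hw, hwv⟩ := hn
    exact (ih hw).succ hwv

theorem RN.no_odd (hirr : ∀ x, ¬ A x x) (hD : ArcLocallyIn A) (hno : NoHole A)
    (hnd : ¬ DomPair A) {x : V} (hx : RN A x) {n : ℕ} (h : Wk A n x x) : Even n := by
  by_contra hn
  rw [Nat.not_even_iff_odd] at hn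
  set S : Set V := {z | Rch A x z} with hS
  have hxS : x ∈ S := Rch.refl x
  have hout : ∀ u v, u ∈ S → A u v → v ∈ S := fun u v hu h => Rch.trans hu (Rch.one h)
  have hin : ∀ u v, v ∈ S → A u v → u ∈ S := fun u v hv h =>
    Rch.trans hv ((hx.rch hv).pred hirr hD hnd h).1
  have := strong_domPair (Ind.irr hirr S) (Ind.ali hD S) (Ind.noHole hno S) (by
    rintro ⟨u, hu⟩ ⟨v, hv⟩
    obtain ⟨m, hm⟩ := (hx.1 u hu).trans hv
    obtain ⟨_, h⟩ := Ind.walk hout hu hm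
    exact ⟨m, h⟩) ⟨n, ⟨x, hxS⟩, hn, (Ind.walk hout hxS h).2⟩
  obtain ⟨⟨u, hu⟩, ⟨v, hv⟩, huv, hd⟩ := this
  refine hnd ⟨u, v, fun e => huv (Subtype.ext e), fun z hzv hzu => ?_⟩
  have hz : z ∈ S := by
    rcases hzu with t | t
    · exact hin _ _ hu t
    · exact hout _ _ hu t
  exact hd ⟨z, hz⟩ (fun e => hzv (congrArg Subtype.val e)) hzu

theorem classify [Finite V] (hirr : ∀ x, ¬ A x x) (hD : ArcLocallyIn A)
    (hnd : ¬ DomPair A) (v : V) : RN A v ∨ (∀ z, ¬ A v z) ∨ (∀ p, ¬ A p v) := by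
  obtain ⟨r, ⟨n, hn⟩, hr⟩ := exists_recu (A := A) v
  by_cases hs : ∃ z, A r z
  · left
    have hRN : RN A r := ⟨hr, hs⟩
    clear hr hs
    induction n generalizing r with
    | zero =>
      have e : v = r := hn
      exact e ▸ hRN
    | succ n ih =>
      obtain ⟨w, hw, hwr⟩ := hn
      exact ih w hw (hRN.pred hirr hD hnd hwr).2
  · push Not at hs
    right
    rcases n with _ | _ | n
    · have e : v = r := hn
      exact Or.inl (e ▸ hs)
    · obtain ⟨w, hw, hwr⟩ := hn
      have e : v = w := hw
      subst e
      exact Or.inr fun p hp => sink_pred hirr hD hnd hs hwr hp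
    · obtain ⟨w, ⟨w', _, hw⟩, hwr⟩ := hn
      exact (sink_pred hirr hD hnd hs hwr hw).elim

theorem key_lemma [Finite V] (hirr : ∀ x, ¬ A x x) (hD : ArcLocallyIn A) (hno : NoHole A) :
    DomPair A ∨ ∃ T : Set V, ∀ u v, A u v → (u ∈ T ↔ v ∉ T) := by
  by_cases hnd : DomPair A
  · exact Or.inl hnd
  right
  let st : Setoid V :=
    { r := fun u v => Rch A u v ∧ Rch A v u
      iseqv := ⟨fun v => ⟨Rch.refl v, Rch.refl v⟩, fun h => ⟨h.2, h.1⟩,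
        fun h1 h2 => ⟨h1.1.trans h2.1, h2.2.trans h1.2⟩⟩ }
  let rt : V → V := fun v => (Quotient.mk st v).out
  have hrt : ∀ v, Rch A (rt v) v ∧ Rch A v (rt v) := fun v => Quotient.mk_out (s := st) v
  have hrt' : ∀ u v, Rch A u v → Rch A v u → rt u = rt v := by
    intro u v h1 h2
    have : Quotient.mk st u = Quotient.mk st v := Quotient.sound (show st.r u v from ⟨h1, h2⟩)
    show (Quotient.mk st u).out = (Quotient.mk st v).out
    rw [this]
  refine ⟨{v | (RN A v ∧ ∃ n, Even n ∧ Wk A n (rt v) v) ∨ ∀ z, ¬ A v z}, fun u v huv => ?_⟩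
  have hus : ¬ ∀ z, ¬ A u z := fun h => h _ huv
  by_cases hv : RN A v
  · obtain ⟨hvu, hu⟩ := hv.pred hirr hD hnd huv
    have e := hrt' u v (Rch.one huv) hvu
    obtain ⟨n, hn⟩ := (hrt u).1
    have hn' : Wk A (n + 1) (rt v) v := ⟨u, e ▸ hn, huv⟩
    obtain ⟨l, hl⟩ := (hrt v).2
    have hroot : RN A (rt v) := hv.rch (hrt v).2
    have par : ∀ m, Wk A m (rt v) v → (Even m ↔ Even l) := fun m hm => by
      have := hroot.no_odd hirr hD hno hnd (hm.trans hl)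
      rwa [Nat.even_add] at this
    have parn : ∀ m, Wk A m (rt u) u → (Even m ↔ ¬ Even l) := fun m hm => by
      have hm' : Wk A (m + 1) (rt v) v := ⟨u, e ▸ hm, huv⟩
      have := par _ hm'
      rw [Nat.even_add_one] at this
      tauto
    have hvs : ¬ ∀ z, ¬ A v z := fun h => by
      obtain ⟨z, hz⟩ := hv.2
      exact h z hz
    constructor
    · rintro (⟨-, m, hm, hmw⟩ | h)
      · rintro (⟨-, m', hm', hmw'⟩ | h)
        · exact ((parn m hmw).1 hm) ((par m' hmw').1 hm')
        · exact hvs h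
      · exact absurd h hus
    · intro hvT
      refine Or.inl ⟨hu, n, ?_, hn⟩
      by_contra hne
      exact hvT (Or.inl ⟨hv, n + 1, by rwa [Nat.even_add_one], hn'⟩)
  · have hu : ¬ RN A u := fun h => hv (h.succ huv)
    have hvs : ∀ z, ¬ A v z := by
      rcases classify hirr hD hnd v with h | h | h
      · exact absurd h hv
      · exact h
      · exact absurd huv (h u)
    constructor
    · rintro (h | h)
      · exact absurd h.1 hu
      · exact absurd h hus
    · intro h
      exact absurd (Or.inr hvs) h

end key

/-! ### Perfection -/

section perfection
variable {A : V → V → Prop}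

theorem DAdj.symm' {a b : V} (h : DAdj A a b) : DAdj A b a := Or.symm h

theorem perf_color [Finite V] (hirr : ∀ x, ¬ A x x) (hD : ArcLocallyIn A) (hno : NoHole A) :
    ∀ (N : ℕ) (S : Set V), S.ncard ≤ N → ∀ n : ℕ,
      (∀ K : Finset V, ↑K ⊆ S → (∀ a ∈ K, ∀ b ∈ K, a ≠ b → DAdj A a b) → K.card ≤ n) →
      ∃ f : V → ℕ, (∀ a ∈ S, f a < n) ∧ ∀ a ∈ S, ∀ b ∈ S, DAdj A a b → f a ≠ f b := by
  classical
  have hirr' : ∀ x, ¬ DAdj A x x := by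
    rintro x (h | h) <;> exact hirr x h
  intro N
  induction N with
  | zero =>
    intro S hS n _
    have h0 : S = ∅ := by
      rwa [Nat.le_zero, Set.ncard_eq_zero (Set.toFinite _)] at hS
    subst h0
    exact ⟨fun _ => 0, fun a ha => ha.elim, fun a ha => ha.elim⟩
  | succ N ih =>
    intro S hS n hn
    rcases key_lemma (Ind.irr hirr S) (Ind.ali hD S) (Ind.noHole hno S) with h | ⟨T, hT⟩
    · obtain ⟨⟨u, hu⟩, ⟨v, hv⟩, huv, hd⟩ := h
      have huv : u ≠ v := fun e => huv (Subtype.ext e)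
      have hd : ∀ x ∈ S, x ≠ v → DAdj A x u → DAdj A x v := fun x hx hxv hxu =>
        hd ⟨x, hx⟩ (fun e => hxv (congrArg Subtype.val e)) hxu
      have hlt : ∀ (S' : Set V) z, S' ⊆ S → z ∈ S → z ∉ S' → S'.ncard ≤ N := by
        intro S' z h1 h2 h3
        have : S'.ncard < S.ncard :=
          Set.ncard_lt_ncard ⟨h1, fun h => h3 (h h2)⟩ (Set.toFinite _)
        omega
      obtain ⟨f, hf1, hf2⟩ := ih (S \ {u}) (hlt _ u Set.sdiff_subset hu (by simp)) n
        (fun K hK hc => hn K (hK.trans Set.sdiff_subset) hc)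
      have hvS : v ∈ S \ {u} := ⟨hv, fun e => huv (Eq.symm e)⟩
      by_cases hadj : DAdj A u v
      · set Z : Set V := {x | x ∈ S ∧ x ≠ u ∧ f x = f v} with hZ
        have hvn := hf1 v hvS
        obtain ⟨g, hg1, hg2⟩ := ih (S \ Z) (hlt _ v Set.sdiff_subset hv
            (fun h => h.2 ⟨hv, huv.symm, rfl⟩)) (n - 1) (by
          intro K hK hc
          have hvK : v ∉ K := fun h => (hK h).2 ⟨hv, huv.symm, rfl⟩
          by_cases huK : u ∈ K
          · have := hn (insert v K) (by
              intro z hz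
              rw [Finset.coe_insert] at hz
              rcases hz with rfl | hz
              · exact hv
              · exact (hK hz).1) (by
              have hz : ∀ z ∈ K, DAdj A z v := by
                intro z hz
                by_cases e : z = u
                · rw [e]; exact hadj
                · exact hd z (hK hz).1 (fun e => hvK (e ▸ hz)) (hc z hz u huK e)
              intro a ha b hb hab
              rw [Finset.mem_insert] at ha hb
              rcases ha with rfl | ha <;> rcases hb with rfl | hb
              · exact absurd rfl hab
              · exact (hz b hb).symm'
              · exact hz a ha
              · exact hc a ha b hb hab)
            rw [Finset.card_insert_of_notMem hvK] at this
            omega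
          · have hKS : ∀ z ∈ K, z ∈ S \ {u} := fun z hz =>
              ⟨(hK hz).1, fun e => huK ((show z = u from e) ▸ hz)⟩
            have hinj : Set.InjOn f K := by
              intro a ha b hb hab
              by_contra hne
              exact hf2 a (hKS a ha) b (hKS b hb) (hc a ha b hb hne) hab
            rw [← Finset.card_image_of_injOn hinj]
            have hsub : K.image f ⊆ (Finset.range n).erase (f v) := by
              intro c hc'
              obtain ⟨z, hz, rfl⟩ := Finset.mem_image.1 hc'
              rw [Finset.mem_erase, Finset.mem_range]
              exact ⟨fun e => (hK hz).2 ⟨(hK hz).1, (hKS z hz).2, e⟩, hf1 z (hKS z hz)⟩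
            have := Finset.card_le_card hsub
            rwa [Finset.card_erase_of_mem (Finset.mem_range.2 hvn), Finset.card_range] at this)
        refine ⟨fun x => if x ∈ Z then n - 1 else g x, ?_, ?_⟩
        · intro a ha
          by_cases haZ : a ∈ Z
          · simp only [haZ, if_true]; omega
          · simp only [haZ, if_false]
            have := hg1 a ⟨ha, haZ⟩
            omega
        · intro a ha b hb hab
          by_cases haZ : a ∈ Z <;> by_cases hbZ : b ∈ Z
          · exfalso
            exact hf2 a ⟨ha, haZ.2.1⟩ b ⟨hb, hbZ.2.1⟩ hab (haZ.2.2.trans hbZ.2.2.symm)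
          · simp only [haZ, hbZ, if_true, if_false]
            have := hg1 b ⟨hb, hbZ⟩
            omega
          · simp only [haZ, hbZ, if_true, if_false]
            have := hg1 a ⟨ha, haZ⟩
            omega
          · simp only [haZ, hbZ, if_false]
            exact hg2 a ⟨ha, haZ⟩ b ⟨hb, hbZ⟩ hab
      · have hb : ∀ b ∈ S, DAdj A b u → f b ≠ f v := by
          intro b hb hbu
          have hbv : b ≠ v := by rintro rfl; exact hadj hbu.symm'
          have hbu' : b ≠ u := by rintro rfl; exact hirr' _ hbu
          exact hf2 b ⟨hb, hbu'⟩ v hvS (hd b hb hbv hbu)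
        refine ⟨fun x => if x = u then f v else f x, ?_, ?_⟩
        · intro a ha
          by_cases hau : a = u
          · simp only [hau, if_true]; exact hf1 v hvS
          · simp only [hau, if_false]; exact hf1 a ⟨ha, hau⟩
        · intro a ha b hb' hab
          by_cases hau : a = u <;> by_cases hbu : b = u
          · subst hau; subst hbu; exact absurd hab (hirr' _)
          · subst hau
            simp only [hbu, if_true, if_false]
            exact (hb b hb' hab.symm').symm
          · subst hbu
            simp only [hau, if_true, if_false]
            exact hb a ha hab
          · simp only [hau, hbu, if_false]
            exact hf2 a ⟨ha, hau⟩ b ⟨hb', hbu⟩ hab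
    · by_cases he : ∃ a ∈ S, ∃ b ∈ S, DAdj A a b
      · obtain ⟨a, ha, b, hb, hab⟩ := he
        have hne : a ≠ b := by rintro rfl; exact hirr' _ hab
        have h2 : 2 ≤ n := by
          have := hn {a, b} (by
            intro z hz
            simp only [Finset.coe_insert, Finset.coe_singleton, Set.mem_insert_iff,
              Set.mem_singleton_iff] at hz
            rcases hz with rfl | rfl <;> assumption) (by
            intro p hp q hq hpq
            simp only [Finset.mem_insert, Finset.mem_singleton] at hp hq
            rcases hp with rfl | rfl <;> rcases hq with rfl | rfl
            · exact absurd rfl hpq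
            · exact hab
            · exact hab.symm'
            · exact absurd rfl hpq)
          rwa [Finset.card_pair hne] at this
        refine ⟨fun v => if ∃ h : v ∈ S, (⟨v, h⟩ : S) ∈ T then 1 else 0, ?_, ?_⟩
        · intro a _
          show (if _ then 1 else 0) < n
          split_ifs <;> omega
        · intro p hp q hq hpq
          have hT' : (⟨p, hp⟩ : S) ∈ T ↔ (⟨q, hq⟩ : S) ∉ T := by
            rcases hpq with t | t
            · exact hT ⟨p, hp⟩ ⟨q, hq⟩ t
            · have := hT ⟨q, hq⟩ ⟨p, hp⟩ t
              tauto
          have e2 : (∃ h : q ∈ S, (⟨q, h⟩ : S) ∈ T) ↔ (⟨q, hq⟩ : S) ∈ T :=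
            ⟨fun ⟨_, h⟩ => h, fun h => ⟨hq, h⟩⟩
          show (if _ then 1 else 0) ≠ (if _ then 1 else 0)
          simp only [e2, hT']
          by_cases h : (⟨q, hq⟩ : S) ∈ T <;> simp [h, hp]
      · refine ⟨fun _ => 0, ?_, fun a ha b hb hab => absurd ⟨a, ha, b, hb, hab⟩ he⟩
        intro a ha
        have := hn {a} (by simpa using ha) (by
          intro p hp q hq hpq
          rw [Finset.mem_singleton] at hp hq
          exact absurd (hp.trans hq.symm) hpq)
        have h1 : ({a} : Finset V).card = 1 := Finset.card_singleton a
        show 0 < n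
        omega

theorem diperfect_of_noHole [Finite V] (hirr : ∀ x, ¬ A x x) (hD : ArcLocallyIn A)
    (hno : NoHole A) : Diperfect A := by
  classical
  intro S
  set G := (Underlying A).induce S with hG
  have hGadj : ∀ a b : S, G.Adj a b ↔ DAdj A a b := by
    intro a b
    simp only [hG, Underlying, SimpleGraph.comap_adj, SimpleGraph.fromRel_adj, DAdj,
      Function.Embedding.subtype_apply]
    constructor
    · exact fun h => h.2
    · intro h
      refine ⟨fun e => ?_, h⟩
      rw [e] at h
      rcases h with h | h <;> exact hirr _ h
  apply le_antisymm
  · obtain ⟨f, hf1, hf2⟩ := perf_color hirr hD hno _ S le_rfl G.cliqueNum (by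
      intro K hK hc
      have hcl : G.IsClique (K.subtype (· ∈ S) : Finset S) := by
        intro a ha b hb hab
        rw [hGadj]
        exact hc a (Finset.mem_subtype.1 ha) b (Finset.mem_subtype.1 hb)
          (fun e => hab (Subtype.ext e))
      have := hcl.card_le_cliqueNum
      rw [Finset.card_subtype] at this
      rwa [Finset.filter_true_of_mem (fun z hz => hK hz)] at this)
    apply SimpleGraph.Colorable.chromaticNumber_le
    refine ⟨SimpleGraph.Coloring.mk (fun v : S => (⟨f v, hf1 v v.2⟩ : Fin G.cliqueNum)) ?_⟩
    intro a b hab e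
    exact hf2 a a.2 b b.2 ((hGadj a b).1 hab) (congrArg Fin.val e)
  · exact G.cliqueNum_le_chromaticNumber

end perfection

/-- A connected arc-locally in-semicomplete digraph is
diperfect, or admits a partition `(V1,V2,V3)` with `D[V1]` semicomplete,
`V1 ↦ V2`, `V1 ⇒ V3`, `D[V2]` an odd extended cycle of length at least five,
`V2 ⇒ V3` and `D[V3]` bipartite (`V1`, `V3` possibly empty), or has a clique cut. -/
theorem stmt_10 {V : Type*} [Fintype V] (A : V → V → Prop) (hirr : Irreflexive A)
    (hD : ArcLocallyIn A) (hconn : IsConnected' A) :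
    Diperfect A ∨
      (∃ V1 V2 V3 : Set V, Disjoint V1 V2 ∧ Disjoint V1 V3 ∧ Disjoint V2 V3 ∧
        V1 ∪ V2 ∪ V3 = Set.univ ∧
        SemicompleteOn A V1 ∧
        (∀ u ∈ V1, ∀ v ∈ V2, A u v) ∧
        (∀ v ∈ V2, ∀ u ∈ V1, ¬ A v u) ∧
        (∀ w ∈ V3, ∀ u ∈ V1, ¬ A w u) ∧
        IsOddExtCycle5On A V2 ∧
        (∀ w ∈ V3, ∀ v ∈ V2, ¬ A w v) ∧
        BipartiteOn A V3) ∨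
      HasCliqueCut A := by
  by_cases hno : NoHole A
  · exact Or.inl (diperfect_of_noHole hirr hD hno)
  · right
    unfold NoHole at hno
    push Not at hno
    obtain ⟨k, hk, hodd, x, hx⟩ := hno
    by_cases hcut : HasCliqueCut A
    · exact Or.inr hcut
    · exact Or.inl (part_one hirr hD hk hodd hx hcut)
end
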